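/- The projective dimension of the R-module R/I_{n-1}(X_G) equals 3 if the graph G has at least one edge, and equals 2 if G has no edges at all. -/

import Mathlib

open MvPolynomial
open scoped Classical

/-- The polynomial ring `R = K[x_{ij} : 1 ≤ i ≤ j ≤ n]`, realized as the multivariate
polynomial ring whose variables are indexed by unordered pairs of elements of `Fin n`
(so that `x_{ij} = x_{ji}` automatically). -/
abbrev SymPolyRing (K : Type*) [Field K] (n : ℕ) := MvPolynomial (Sym2 (Fin n)) K


/-- The sparse generic symmetric `n × n` matrix `X_G` associated to a simple graph `G`
on `[n]`: its `(i,j)` entry is the variable `x_{ij}` if `i = j` or `ij` is an edge of `G`,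
and `0` otherwise (i.e. all variables in `Z` are replaced by `0`). -/
noncomputable def sparseGenericSym (K : Type*) [Field K] (n : ℕ) (G : SimpleGraph (Fin n)) :
    Matrix (Fin n) (Fin n) (SymPolyRing K n) :=
  fun i j => if i = j ∨ G.Adj i j then MvPolynomial.X s(i, j) else 0


/-- The ideal of `k × k` minors of a square matrix `M` over a commutative ring: it is
generated by the determinants of all `k × k` submatrices of `M` (given by choosing `k`
distinct rows and `k` distinct columns). -/
noncomputable def minorsIdeal {R : Type*} [CommRing R] {n : ℕ} (k : ℕ)
    (M : Matrix (Fin n) (Fin n) R) : Ideal R :=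
  Ideal.span { d | ∃ f g : Fin k → Fin n,
    Function.Injective f ∧ Function.Injective g ∧ d = (M.submatrix f g).det }



section Homological
open CategoryTheory CategoryTheory.Limits CategoryTheory.Abelian

universe uu vv
variable {C : Type uu} [Category.{vv} C] [Abelian C]

/-- Splicing a projective resolution of the kernel with a projective cover. -/
lemma exists_resolution_of_shortExact (S : ShortComplex C) (hS : S.ShortExact)
    (hP : Projective S.X₂) (k : ℕ)
    (h : ∃ P : ProjectiveResolution S.X₁, ∀ i, k < i → IsZero (P.complex.X i)) :
    ∃ P : ProjectiveResolution S.X₃, ∀ i, k + 1 < i → IsZero (P.complex.X i) := by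
  obtain ⟨P, hPz⟩ := h
  have := hS.epi_g
  have := hS.mono_f
  obtain ⟨ε, hε, wε, hexε⟩ : ∃ ε : P.complex.X 0 ⟶ S.X₁, Epi ε ∧
      ∃ w : P.complex.d 1 0 ≫ ε = 0, (ShortComplex.mk _ _ w).Exact :=
    ⟨P.π.f 0, (inferInstance : @Epi C _ (P.complex.X 0) (((ChainComplex.single₀ C).obj S.X₁).X 0)
        (P.π.f 0)), P.complex_d_comp_π_f_zero,
      ShortComplex.exact_of_g_is_cokernel _ P.isColimitCokernelCofork⟩
  let f : P.complex.X 0 ⟶ S.X₂ := ε ≫ S.f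
  have w : P.complex.d 1 0 ≫ f = 0 := by
    simp only [f]
    rw [← Category.assoc, wε, zero_comp]
  have hex0 : (ShortComplex.mk f S.g (by simp [f])).Exact := by
    have h1 := hS.exact
    rw [ShortComplex.exact_iff_exact_up_to_refinements] at h1 ⊢
    intro A x₂ hx₂
    obtain ⟨A', π, hπ, x₁, hx₁⟩ := h1 x₂ hx₂
    obtain ⟨A'', π', hπ', y, hy⟩ := surjective_up_to_refinements_of_epi ε x₁
    refine ⟨A'', π' ≫ π, inferInstance, y, ?_⟩
    dsimp at *
    rw [Category.assoc, hx₁, ← Category.assoc, hy, Category.assoc]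
  have hex1 : (ShortComplex.mk (P.complex.d 1 0) f w).Exact := by
    have h1 := hexε
    rw [ShortComplex.exact_iff_exact_up_to_refinements] at h1 ⊢
    intro A x₂ hx₂
    have : x₂ ≫ ε = 0 := by
      rw [← cancel_mono S.f]
      simpa [f] using hx₂
    exact h1 x₂ this
  let D := ChainComplex.augment P.complex f w
  have hDex : ∀ n, D.ExactAt (n + 1) := by
    intro n
    rw [HomologicalComplex.exactAt_iff' _ (n + 1 + 1) (n + 1) n (by simp) (by simp)]
    cases n with
    | zero => exact hex1
    | succ n => exact P.exact_succ n
  refine ⟨{ complex := D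
            projective := fun n => by
              cases n with
              | zero => exact hP
              | succ n => exact P.projective n
            π := (ChainComplex.toSingle₀Equiv _ _).symm ⟨S.g, by
              change f ≫ S.g = 0
              simp [f]⟩
            quasiIso := ⟨fun n => ?_⟩ }, ?_⟩
  · cases n with
    | zero =>
      rw [ChainComplex.quasiIsoAt₀_iff, ShortComplex.quasiIso_iff_of_zeros']
      · refine (ShortComplex.exact_and_epi_g_iff_of_iso ?_).2 ⟨hex0, by dsimp; infer_instance⟩
        refine ShortComplex.isoMk (Iso.refl _) (Iso.refl _) (Iso.refl _) ?_ ?_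
        · change 𝟙 _ ≫ f = D.d 1 0 ≫ 𝟙 _
          erw [Category.id_comp, Category.comp_id]
          rfl
        · change 𝟙 _ ≫ S.g = _ ≫ 𝟙 _
          erw [Category.id_comp, Category.comp_id]
          have key : ∀ hf, ((ChainComplex.toSingle₀Equiv D S.X₃).symm ⟨S.g, hf⟩).f 0 = S.g :=
            fun hf => ChainComplex.toSingle₀Equiv_symm_apply_f_zero _ _
          exact (key _).symm
      all_goals rfl
    | succ n =>
      rw [quasiIsoAt_iff_exactAt']
      · exact hDex n
      · apply ChainComplex.exactAt_succ_single_obj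
  · intro i hi
    cases i with
    | zero => omega
    | succ i => exact hPz i (by omega)

lemma exists_resolution_iff [EnoughProjectives C] (Z : C) (k : ℕ) :
    (∃ P : ProjectiveResolution Z, ∀ i, k < i → IsZero (P.complex.X i)) ↔
      HasProjectiveDimensionLT Z (k + 1) := by
  constructor
  · rintro ⟨P, hP⟩
    let := HasExt.standard C
    rw [hasProjectiveDimensionLT_iff]
    intro i hi Y e
    obtain ⟨f, hf, rfl⟩ := P.extMk_surjective e (i + 1) rfl
    obtain rfl : f = 0 := (hP i (by omega)).eq_of_src _ _
    exact P.extMk_zero _ _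
  · induction k generalizing Z with
    | zero =>
      intro h
      have : Projective Z := projective_iff_hasProjectiveDimensionLT_one.2 h
      refine ⟨ProjectiveResolution.self Z, fun i hi => ?_⟩
      apply HomologicalComplex.isZero_single_obj_X
      simp; omega
    | succ k ih =>
      intro h
      let S : ShortComplex C := ShortComplex.mk (kernel.ι (Projective.π Z)) (Projective.π Z)
        (kernel.condition _)
      have hS : S.ShortExact :=
        { exact := ShortComplex.exact_kernel (Projective.π Z)
          mono_f := by dsimp [S]; infer_instance
          epi_g := by dsimp [S]; infer_instance }
      have hp : Projective S.X₂ := Projective.projective_over Z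
      exact exists_resolution_of_shortExact S hS hp k
        (ih _ ((hS.hasProjectiveDimensionLT_X₃_iff k hp).1 h))

end Homological


section PdLT
open CategoryTheory
universe u
variable {R : Type u} [CommRing R]

/-- Projective dimension `< n` for an unbundled module. -/
def PdLT (R : Type u) [CommRing R] (M : Type u) [AddCommGroup M] [Module R M] (n : ℕ) : Prop :=
  HasProjectiveDimensionLT (ModuleCat.of R M) n

variable {A B C : Type u} [AddCommGroup A] [AddCommGroup B] [AddCommGroup C]
  [Module R A] [Module R B] [Module R C]

lemma PdLT.mono {m n : ℕ} (h : PdLT R A m) (hmn : m ≤ n) : PdLT R A n :=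
  @hasProjectiveDimensionLT_of_ge _ _ _ (ModuleCat.of R A) m n hmn h

lemma PdLT.of_projective [Module.Projective R A] : PdLT R A 1 := by
  have : Projective (ModuleCat.of R A) := (IsProjective.iff_projective A).1 inferInstance
  exact projective_iff_hasProjectiveDimensionLT_one.1 this

lemma PdLT.of_equiv {n : ℕ} (e : A ≃ₗ[R] B) (h : PdLT R A n) : PdLT R B n :=
  @hasProjectiveDimensionLT_of_iso _ _ _ _ _ e.toModuleIso n h

lemma shortExact_of_linear (f : A →ₗ[R] B) (g : B →ₗ[R] C) (hf : Function.Injective f)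
    (hg : Function.Surjective g) (hfg : Function.Exact f g) :
    (ShortComplex.mk (ModuleCat.ofHom f) (ModuleCat.ofHom g)
      (by ext x; exact hfg.apply_apply_eq_zero x)).ShortExact where
  exact := (ShortComplex.moduleCat_exact_iff _).2 (fun x hx => (hfg x).1 hx)
  mono_f := (ModuleCat.mono_iff_injective _).2 hf
  epi_g := (ModuleCat.epi_iff_surjective _).2 hg

lemma PdLT.of_exact {n : ℕ} (f : A →ₗ[R] B) (g : B →ₗ[R] C) (hf : Function.Injective f)
    (hg : Function.Surjective g) (hfg : Function.Exact f g)
    (hA : PdLT R A n) (hB : PdLT R B (n + 1)) : PdLT R C (n + 1) :=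
  (shortExact_of_linear f g hf hg hfg).hasProjectiveDimensionLT_X₃ n hA hB

lemma PdLT.prod {n : ℕ} (hA : PdLT R A n) (hB : PdLT R B n) : PdLT R (A × B) n :=
  (shortExact_of_linear (LinearMap.inl R A B) (LinearMap.snd R A B)
    LinearMap.inl_injective LinearMap.snd_surjective
    (LinearMap.exact_iff.2 (LinearMap.ker_snd ..))).hasProjectiveDimensionLT_X₂ n hA hB

lemma PdLT.of_ker {n : ℕ} (g : B →ₗ[R] C) (hg : Function.Surjective g)
    (hA : PdLT R (LinearMap.ker g) n) (hB : PdLT R B (n + 1)) : PdLT R C (n + 1) :=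
  PdLT.of_exact (LinearMap.ker g).subtype g (Submodule.subtype_injective _) hg
    (LinearMap.exact_subtype_ker_map g) hA hB

end PdLT

section Alt
universe u
variable {R : Type u} [CommRing R] {V : Type}

/-- Alternating matrices. -/
def altMat (R : Type u) [CommRing R] (V : Type) : Submodule R (Matrix V V R) where
  carrier := {A | A.transpose = -A ∧ ∀ i, A i i = 0}
  add_mem' := by
    rintro A B ⟨hA, hA'⟩ ⟨hB, hB'⟩
    refine ⟨by rw [Matrix.transpose_add, hA, hB, neg_add], fun i => by simp [hA', hB']⟩
  zero_mem' := by simp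
  smul_mem' := by
    rintro c A ⟨hA, hA'⟩
    exact ⟨by rw [Matrix.transpose_smul, hA, smul_neg], fun i => by simp [hA']⟩

lemma mem_altMat {A : Matrix V V R} :
    A ∈ altMat R V ↔ A.transpose = -A ∧ ∀ i, A i i = 0 := Iff.rfl

lemma mem_altMat' {A : Matrix V V R} :
    A ∈ altMat R V ↔ (∀ i j, A j i = -A i j) ∧ ∀ i, A i i = 0 := by
  rw [mem_altMat]
  refine and_congr_left fun _ => ⟨fun h i j => congrFun (congrFun h i) j, fun h => ?_⟩
  ext i j
  exact h i j

lemma sub_transpose_mem_altMat (A : Matrix V V R) : A - A.transpose ∈ altMat R V := by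
  rw [mem_altMat']
  exact ⟨fun i j => by simp, fun i => by simp⟩

instance altMat_projective [Finite V] : Module.Projective R (altMat R V) := by
  obtain ⟨n, ⟨e⟩⟩ := Finite.exists_equiv_fin V
  let i : altMat R V →ₗ[R] Matrix V V R :=
    { toFun := fun A => Matrix.of fun i j => if e i < e j then A.1 i j else 0
      map_add' := by
        intro A B; ext i j
        by_cases h : e i < e j <;> simp [h]
      map_smul' := by
        intro c A; ext i j
        by_cases h : e i < e j <;> simp [h] }
  let s : Matrix V V R →ₗ[R] altMat R V :=
    LinearMap.codRestrict _ (LinearMap.id - (Matrix.transposeLinearEquiv V V R R).toLinearMap)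
      (fun A => sub_transpose_mem_altMat A)
  refine Module.Projective.of_split i s ?_
  ext A a b
  have hA := mem_altMat'.1 A.2
  change (if e a < e b then A.1 a b else 0) - (if e b < e a then A.1 b a else 0) = A.1 a b
  rcases lt_trichotomy (e a) (e b) with h | h | h
  · simp [h, h.not_gt]
  · have : a = b := e.injective h
    subst this
    simp [hA.2]
  · simp [h, h.not_gt, hA.1 a b]

lemma exists_upper [Finite V] {A : Matrix V V R} (hA : A ∈ altMat R V) :
    ∃ U : Matrix V V R, A = U - U.transpose := by
  obtain ⟨n, ⟨e⟩⟩ := Finite.exists_equiv_fin V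
  refine ⟨Matrix.of fun i j => if e i < e j then A i j else 0, ?_⟩
  ext a b
  have hA := mem_altMat'.1 hA
  change _ = (if e a < e b then A a b else 0) - (if e b < e a then A b a else 0)
  rcases lt_trichotomy (e a) (e b) with h | h | h
  · simp [h, h.not_gt]
  · have : a = b := e.injective h
    subst this
    simp [hA.2]
  · simp [h, h.not_gt, hA.1 a b]

/-- Sandwiching an alternating matrix. -/
lemma transpose_mul_alt_mul [Fintype V] {A : Matrix V V R} (hA : A ∈ altMat R V) (P : Matrix V V R) :
    P.transpose * A * P ∈ altMat R V := by
  obtain ⟨U, hU⟩ := exists_upper hA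
  have : P.transpose * A * P = (P.transpose * U * P) - (P.transpose * U * P).transpose := by
    rw [hU]
    simp [Matrix.mul_sub, Matrix.sub_mul, Matrix.transpose_mul, Matrix.mul_assoc]
  rw [this]
  exact sub_transpose_mem_altMat _

/-- alternating matrices pair to zero with symmetric ones -/
lemma trace_alt_mul [Fintype V] {A S : Matrix V V R} (hA : A ∈ altMat R V) (hS : S.transpose = S) :
    (A * S).trace = 0 := by
  obtain ⟨U, hU⟩ := exists_upper hA
  rw [hU, Matrix.sub_mul, Matrix.trace_sub, sub_eq_zero]
  nth_rewrite 2 [← Matrix.trace_transpose]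
  rw [Matrix.transpose_mul, Matrix.transpose_transpose, hS, Matrix.trace_mul_comm]

end Alt


section Good
set_option linter.unusedSectionVars false
universe u
variable {R : Type u} [CommRing R] [IsDomain R] {V : Type} [Fintype V] [DecidableEq V]
open Matrix

/-- key vanishing lemma: a vector killed by `X` modulo `Δ` with `v`-coordinate zero vanishes
modulo `Δ`, if `Δ` and the principal minor at `v` are coprime. -/
lemma dvd_of_mulVec_dvd {X : Matrix V V R} {v : V}
    (H : ∀ d, X.det ∣ X.adjugate v v * d → X.det ∣ d) (f : V → R)
    (hf : ∀ i, X.det ∣ (X *ᵥ f) i) (hv : X.det ∣ f v) (w : V) : X.det ∣ f w := by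
  apply H
  set X' := X.updateRow v (Pi.single v 1) with hX'
  have hdet : X'.det = X.adjugate v v := by rw [Matrix.adjugate_apply]
  have h1 : ∀ i, X.det ∣ (X' *ᵥ f) i := by
    intro i
    by_cases h : i = v
    · subst h
      simpa [hX', Matrix.mulVec, dotProduct, Pi.single_apply] using hv
    · have : (X' *ᵥ f) i = (X *ᵥ f) i := by
        simp [hX', Matrix.mulVec, dotProduct, Matrix.updateRow_ne h]
      rw [this]; exact hf i
  have h2 : (X'.adjugate *ᵥ (X' *ᵥ f)) w = X.adjugate v v * f w := by
    rw [Matrix.mulVec_mulVec, Matrix.adjugate_mul, hdet, Matrix.smul_mulVec, Matrix.one_mulVec]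
    simp
  rw [← h2]
  exact Finset.dvd_sum fun i _ => Dvd.dvd.mul_left (h1 i) _

lemma mem_range_of_adj_dvd {X : Matrix V V R} (h0 : X.det ≠ 0) {u : V}
    (H : ∀ d, X.det ∣ X.adjugate u u * d → X.det ∣ d) (l : V → R)
    (hl : X.det ∣ (X.adjugate *ᵥ l) u) : ∃ f, l = X *ᵥ f := by
  have h1 : X *ᵥ (X.adjugate *ᵥ l) = X.det • l := by
    rw [Matrix.mulVec_mulVec, Matrix.mul_adjugate, Matrix.smul_mulVec, Matrix.one_mulVec]
  have h2 := dvd_of_mulVec_dvd H (X.adjugate *ᵥ l) (fun i => by rw [h1]; simp) hl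
  choose g hg using h2
  refine ⟨g, ?_⟩
  have h3 : X.adjugate *ᵥ l = X.det • g := by ext i; simpa using hg i
  rw [h3, Matrix.mulVec_smul] at h1
  ext i
  have := congrFun h1 i
  simp only [Pi.smul_apply, smul_eq_mul] at this
  exact (mul_left_cancel₀ h0 this).symm

lemma adj_symm {X : Matrix V V R} (hs : X.transpose = X) : X.adjugate.transpose = X.adjugate := by
  rw [Matrix.adjugate_transpose, hs]

lemma adj_minor_dvd {X : Matrix V V R} (hs : X.transpose = X) {v : V}
    (H : ∀ d, X.det ∣ X.adjugate v v * d → X.det ∣ d) (w : V) :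
    X.det ∣ X.adjugate v v * X.adjugate w w - X.adjugate v w * X.adjugate v w := by
  have hcol : ∀ j i, X.det ∣ (X *ᵥ (fun k => X.adjugate k j)) i := by
    intro j i
    have : (X *ᵥ (fun k => X.adjugate k j)) i = (X * X.adjugate) i j := rfl
    rw [this, Matrix.mul_adjugate]
    simp
  have h := dvd_of_mulVec_dvd H
    (X.adjugate v v • (fun k => X.adjugate k w) - X.adjugate v w • (fun k => X.adjugate k v))
    (fun i => by
      rw [Matrix.mulVec_sub, Matrix.mulVec_smul, Matrix.mulVec_smul]
      exact dvd_sub ((hcol _ i).mul_left _) ((hcol _ i).mul_left _))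
    (by simp [mul_comm]) w
  have h4 : X.adjugate w v = X.adjugate v w := congrFun (congrFun (adj_symm hs) v) w
  simpa [h4] using h

/-- The properties of generic enough symmetric matrices used in the resolution. -/
structure GoodMat (X : Matrix V V R) : Prop where
  symm : X.transpose = X
  det_ne : X.det ≠ 0
  adj_ne : ∀ u w, X.adjugate u w ≠ 0
  H : ∀ u d, X.det ∣ X.adjugate u u * d → X.det ∣ d
  E : ∀ Q : Matrix V V R, X.det ∣ (Q * X.adjugate).trace →
    ∃ C, ∃ A ∈ altMat R V, Q = X * C + A

lemma GoodMat.exists_alt [Nonempty V] {X : Matrix V V R} (hX : GoodMat X) (C : Matrix V V R)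
    (hC : X * C ∈ altMat R V) : ∃ A ∈ altMat R V, C = A * X := by
  obtain ⟨v⟩ := ‹Nonempty V›
  set D := C * X.adjugate with hD
  have hDalt : D ∈ altMat R V := by
    have h1 : X.adjugate.transpose * (X * C) * X.adjugate = X.det • D := by
      rw [adj_symm hX.symm, ← Matrix.mul_assoc, Matrix.adjugate_mul, hD]
      simp
    have h2 := transpose_mul_alt_mul hC X.adjugate
    rw [h1, mem_altMat'] at h2
    rw [mem_altMat']
    refine ⟨fun i j => mul_left_cancel₀ hX.det_ne ?_, fun i => mul_left_cancel₀ hX.det_ne ?_⟩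
    · have := h2.1 i j
      simpa using this
    · simpa using h2.2 i
  have hDX : D * X = X.det • C := by
    rw [hD, Matrix.mul_assoc, Matrix.adjugate_mul]; simp
  have hDa := mem_altMat'.1 hDalt
  have hrow : ∀ i k, X.det ∣ (X *ᵥ (D i)) k := by
    intro i k
    have : (X *ᵥ (D i)) k = (D * X) i k := by
      simp only [Matrix.mulVec, dotProduct, Matrix.mul_apply]
      refine Finset.sum_congr rfl fun j _ => ?_
      rw [mul_comm]
      congr 1
      exact congrFun (congrFun hX.symm j) k
    rw [this, hDX]
    simp
  have h1 : ∀ w, X.det ∣ D v w :=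
    dvd_of_mulVec_dvd (hX.H v) (D v) (hrow v) (by simp [hDa.2])
  have h2 : ∀ i w, X.det ∣ D i w := fun i =>
    dvd_of_mulVec_dvd (hX.H v) (D i) (hrow i) (by rw [hDa.1 v i]; simpa using h1 i)
  choose A hA using h2
  refine ⟨Matrix.of A, ?_, ?_⟩
  · rw [mem_altMat']
    refine ⟨fun i j => mul_left_cancel₀ hX.det_ne ?_, fun i => mul_left_cancel₀ hX.det_ne ?_⟩
    · have := hDa.1 i j
      rw [hA, hA] at this
      simpa using this
    · have := hDa.2 i
      rw [hA] at this
      simpa using this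
  · have h3 : D = X.det • Matrix.of A := by ext i j; simpa using hA i j
    rw [h3, Matrix.smul_mul] at hDX
    ext i j
    have := congrFun (congrFun hDX i) j
    simp only [Matrix.smul_apply, smul_eq_mul] at this
    exact (mul_left_cancel₀ hX.det_ne this).symm

/-- The ideal generated by the entries of the adjugate. -/
def adjIdeal (X : Matrix V V R) : Ideal R := Ideal.span (Set.range fun p : V × V => X.adjugate p.1 p.2)

lemma trace_mul_adj_mem (X Q : Matrix V V R) : (Q * X.adjugate).trace ∈ adjIdeal X := by
  simp only [Matrix.trace, Matrix.diag_apply, Matrix.mul_apply]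
  refine Ideal.sum_mem _ fun i _ => Ideal.sum_mem _ fun j _ => Ideal.mul_mem_left _ _ ?_
  exact Ideal.subset_span ⟨(j, i), rfl⟩

lemma exists_trace_of_mem (X : Matrix V V R) {y : R} (hy : y ∈ adjIdeal X) :
    ∃ Q : Matrix V V R, (Q * X.adjugate).trace = y := by
  induction hy using Submodule.span_induction with
  | mem x hx =>
    obtain ⟨p, rfl⟩ := hx
    refine ⟨Matrix.single p.2 p.1 1, ?_⟩
    rw [Matrix.trace_single_mul]
    simp
  | zero => exact ⟨0, by simp⟩
  | add x y _ _ hx hy =>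
    obtain ⟨Q, rfl⟩ := hx
    obtain ⟨Q', rfl⟩ := hy
    exact ⟨Q + Q', by rw [Matrix.add_mul, Matrix.trace_add]⟩
  | smul a x _ hx =>
    obtain ⟨Q, rfl⟩ := hx
    exact ⟨a • Q, by rw [Matrix.smul_mul, Matrix.trace_smul]⟩

lemma det_mem_adjIdeal [Nonempty V] (X : Matrix V V R) : X.det ∈ adjIdeal X := by
  obtain ⟨v⟩ := ‹Nonempty V›
  have : X.det = (X * X.adjugate) v v := by rw [Matrix.mul_adjugate]; simp
  rw [this, Matrix.mul_apply]
  exact Ideal.sum_mem _ fun j _ => Ideal.mul_mem_left _ _ (Ideal.subset_span ⟨(j, v), rfl⟩)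

lemma trace_XC (X C A : Matrix V V R) (hs : X.transpose = X) (hA : A ∈ altMat R V) :
    ((X * C + A) * X.adjugate).trace = C.trace * X.det := by
  rw [Matrix.add_mul, Matrix.trace_add, trace_alt_mul hA (adj_symm hs), add_zero,
    Matrix.mul_assoc, Matrix.trace_mul_comm, Matrix.mul_assoc, Matrix.adjugate_mul]
  simp [mul_comm]

set_option maxHeartbeats 1000000 in
lemma GoodMat.pdLT [Nonempty V] {X : Matrix V V R} (hX : GoodMat X) : PdLT R (adjIdeal X) 3 := by
  -- the augmentation
  let g₀ : R × Matrix V V R →ₗ[R] R :=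
    LinearMap.coprod (-(LinearMap.toSpanSingleton R R X.det))
      ((Matrix.traceLinearMap V R R).comp (LinearMap.mulRight R X.adjugate))
  have hg₀ : ∀ p, g₀ p = -(p.1 * X.det) + (p.2 * X.adjugate).trace := by
    intro p; simp [g₀, LinearMap.toSpanSingleton_apply]
  let g : R × Matrix V V R →ₗ[R] adjIdeal X := g₀.codRestrict (adjIdeal X) (fun p => by
    rw [hg₀]
    exact Ideal.add_mem _ (neg_mem (Ideal.mul_mem_left _ _ (det_mem_adjIdeal X)))
      (trace_mul_adj_mem X _))
  have hgs : Function.Surjective g := by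
    rintro ⟨y, hy⟩
    obtain ⟨Q, hQ⟩ := exists_trace_of_mem X hy
    exact ⟨(0, Q), Subtype.ext (by simp [g, hg₀, hQ])⟩
  have hgker : ∀ p, p ∈ LinearMap.ker g ↔ (p.2 * X.adjugate).trace = p.1 * X.det := by
    intro p
    rw [LinearMap.mem_ker, Subtype.ext_iff]
    change g₀ p = 0 ↔ _
    rw [hg₀]
    constructor
    · intro h; linear_combination h
    · intro h; linear_combination h
  refine PdLT.of_ker g hgs ?_ (PdLT.of_projective.mono (by norm_num))
  let h₀ : Matrix V V R × altMat R V →ₗ[R] R × Matrix V V R :=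
    LinearMap.coprod
      (LinearMap.prod (Matrix.traceLinearMap V R R) (LinearMap.mulLeft R X))
      (LinearMap.prod 0 (altMat R V).subtype)
  have hh₀ : ∀ p, h₀ p = (p.1.trace, X * p.1 + p.2.1) := by
    intro p; simp [h₀]
  let h : Matrix V V R × altMat R V →ₗ[R] LinearMap.ker g := h₀.codRestrict _ (fun p => by
    rw [hgker, hh₀]
    exact trace_XC X _ _ hX.symm p.2.2)
  have hhs : Function.Surjective h := by
    rintro ⟨⟨r, Q⟩, hp⟩
    rw [hgker] at hp
    obtain ⟨C, A, hA, rfl⟩ := hX.E Q ⟨r, by rw [mul_comm]; exact hp⟩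
    refine ⟨(C, ⟨A, hA⟩), Subtype.ext ?_⟩
    change h₀ _ = _
    rw [hh₀]
    simp only [trace_XC X _ _ hX.symm hA] at hp
    exact Prod.ext (mul_right_cancel₀ hX.det_ne hp) rfl
  refine PdLT.of_ker h hhs ?_ (PdLT.of_projective.mono (by norm_num))
  have hhker : ∀ p, p ∈ LinearMap.ker h ↔ p.1.trace = 0 ∧ X * p.1 + p.2.1 = 0 := by
    intro p
    rw [LinearMap.mem_ker, Subtype.ext_iff]
    change h₀ p = 0 ↔ _
    rw [hh₀]
    exact Prod.ext_iff
  have hsand : ∀ A : altMat R V, X * (A.1 * X) ∈ altMat R V := by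
    intro A
    have := transpose_mul_alt_mul A.2 X
    rwa [hX.symm, Matrix.mul_assoc] at this
  let k₁ : altMat R V →ₗ[R] altMat R V :=
    (-((LinearMap.mulLeft R X).comp ((LinearMap.mulRight R X).comp (altMat R V).subtype))).codRestrict
      (altMat R V) (fun A => neg_mem (hsand A))
  let k₀ : altMat R V →ₗ[R] Matrix V V R × altMat R V :=
    LinearMap.prod ((LinearMap.mulRight R X).comp (altMat R V).subtype) k₁
  have hk₀ : ∀ A, (k₀ A).1 = A.1 * X := fun A => rfl
  have hk₀' : ∀ A, (k₀ A).2.1 = -(X * (A.1 * X)) := fun A => rfl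
  let k : altMat R V →ₗ[R] LinearMap.ker h := k₀.codRestrict _ (fun A => by
        rw [hhker, hk₀, hk₀']
        exact ⟨trace_alt_mul A.2 hX.symm, add_neg_cancel _⟩)
  have hkb : Function.Bijective k := by
    constructor
    · intro A B hAB
      have h1 : A.1 * X = B.1 * X := congrArg (fun t : LinearMap.ker h => t.1.1) hAB
      have h2 := congrArg (· * X.adjugate) h1
      simp only [Matrix.mul_assoc, Matrix.mul_adjugate] at h2
      apply Subtype.ext
      ext i j
      have := congrFun (congrFun h2 i) j
      simp only [Matrix.mul_smul, Matrix.mul_one, Matrix.smul_apply, smul_eq_mul] at this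
      exact mul_left_cancel₀ hX.det_ne this
    · rintro ⟨⟨C, A⟩, hp⟩
      rw [hhker] at hp
      have h2 : X * C = -A.1 := eq_neg_of_add_eq_zero_left hp.2
      obtain ⟨A', hA', rfl⟩ := hX.exists_alt C (by rw [h2]; exact neg_mem A.2)
      refine ⟨⟨A', hA'⟩, Subtype.ext (Prod.ext rfl (Subtype.ext ?_))⟩
      change -(X * (A' * X)) = A.1
      rw [h2, neg_neg]
  exact PdLT.of_equiv (LinearEquiv.ofBijective k hkb) PdLT.of_projective

end Good


section Kill
set_option linter.unusedSectionVars false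
universe u
variable {K : Type u} [Field K] {σ : Type}

/-- substitution of zero for one variable -/
noncomputable def kill (s : σ) : MvPolynomial σ K →ₐ[K] MvPolynomial σ K :=
  aeval (fun t => if t = s then 0 else X t)

lemma kill_X (s t : σ) : kill s (X t : MvPolynomial σ K) = if t = s then 0 else X t := by
  simp [kill]

@[simp] lemma kill_X_self (s : σ) : kill s (X s : MvPolynomial σ K) = 0 := by simp [kill_X]

lemma kill_X_ne {s t : σ} (h : t ≠ s) : kill s (X t : MvPolynomial σ K) = X t := by
  simp [kill_X, h]

lemma X_dvd_sub_kill (s : σ) (p : MvPolynomial σ K) : X s ∣ p - kill s p := by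
  induction p using MvPolynomial.induction_on with
  | C a => simp [kill]
  | add p q hp hq =>
    rw [map_add]
    have := dvd_add hp hq
    convert this using 1; ring
  | mul_X p t hp =>
    rw [map_mul, kill_X]
    split_ifs with h
    · subst h; simp
    · rw [← sub_mul]; exact hp.mul_right _

lemma X_dvd_iff_kill (s : σ) (p : MvPolynomial σ K) : X s ∣ p ↔ kill s p = 0 := by
  constructor
  · rintro ⟨q, rfl⟩; simp
  · intro h; simpa [h] using X_dvd_sub_kill s p

lemma exists_eq_kill (s : σ) (p : MvPolynomial σ K) : ∃ q, p = kill s p + X s * q := by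
  obtain ⟨q, hq⟩ := X_dvd_sub_kill s p
  exact ⟨q, by rw [← hq]; ring⟩

lemma prime_X' (s : σ) : Prime (X s : MvPolynomial σ K) := by
  refine ⟨X_ne_zero s, fun h => ?_, fun a b h => ?_⟩
  · have := h.map (kill (K := K) s)
    simp at this
  · rw [X_dvd_iff_kill, map_mul, mul_eq_zero] at h
    rwa [X_dvd_iff_kill, X_dvd_iff_kill]

lemma kill_eq_self_iff (s : σ) (p : MvPolynomial σ K) : kill s p = p ↔ degreeOf s p = 0 := by
  constructor
  · intro h
    rw [← h]
    have : ∀ q : MvPolynomial σ K, degreeOf s (kill s q) = 0 := by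
      intro q
      induction q using MvPolynomial.induction_on with
      | C a => simp [kill]
      | add p q hp hq =>
        rw [map_add]
        have := degreeOf_add_le s (kill s p) (kill s q)
        rw [hp, hq] at this
        simpa using this
      | mul_X p t hp =>
        rw [map_mul, kill_X]
        split_ifs with h
        · simp
        · have := degreeOf_mul_le s (kill s p) (X t)
          rw [hp, degreeOf_X_of_ne (Ne.symm h)] at this
          simpa using this
    exact this p
  · intro h
    have h1 : (aeval (fun t => if t = s then (0 : MvPolynomial σ K) else X t)) p =
        (aeval (X : σ → MvPolynomial σ K)) p := by
      apply MvPolynomial.eval₂Hom_congr' rfl _ rfl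
      intro i hi _
      have : i ≠ s := by
        rintro rfl
        exact mem_vars_iff_degreeOf_ne_zero.1 hi h
      simp [this]
    rw [kill, h1]; simp

lemma kill_of_dvd {s : σ} {p q : MvPolynomial σ K} (hpq : p ∣ q) (hq : q ≠ 0)
    (h : kill s q = q) : kill s p = p := by
  obtain ⟨r, rfl⟩ := hpq
  rw [kill_eq_self_iff] at *
  rw [degreeOf_mul_eq (left_ne_zero_of_mul hq) (right_ne_zero_of_mul hq)] at h
  omega

lemma isUnit_of_kill {p : MvPolynomial σ K} (hp : p ≠ 0) (h : ∀ s, kill s p = p) : IsUnit p := by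
  have : p.totalDegree = 0 := by
    rw [totalDegree_eq_zero_iff]
    intro m hm s
    have := (kill_eq_self_iff s p).1 (h s)
    have h2 := monomial_le_degreeOf s hm
    omega
  rw [totalDegree_eq_zero_iff_eq_C] at this
  rw [this]
  rw [this] at hp
  have : coeff 0 p ≠ 0 := by rintro h; rw [h] at hp; simp at hp
  exact (IsUnit.mk0 _ this).map C

lemma hc_mul {p : MvPolynomial σ K} {m : ℕ} (hp : p.IsHomogeneous m) (d : ℕ)
    (q : MvPolynomial σ K) :
    homogeneousComponent (m + d) (p * q) = p * homogeneousComponent d q := by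
  conv_lhs => rw [← sum_homogeneousComponent q, Finset.mul_sum, map_sum]
  have : ∀ i, homogeneousComponent (m + d) (p * homogeneousComponent i q) =
      if i = d then p * homogeneousComponent d q else 0 := by
    intro i
    rw [homogeneousComponent_of_mem (hp.mul (homogeneousComponent_isHomogeneous i q))]
    by_cases h : i = d
    · subst h; simp
    · simp [h, Ne.symm h]
  simp only [this, Finset.sum_ite_eq', Finset.mem_range]
  split_ifs with h
  · rfl
  · rw [homogeneousComponent_eq_zero _ _ (by omega), mul_zero]

lemma hc_mul_lt {p : MvPolynomial σ K} {m : ℕ} (hp : p.IsHomogeneous m) {d : ℕ} (hd : d < m)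
    (q : MvPolynomial σ K) :
    homogeneousComponent d (p * q) = 0 := by
  conv_lhs => rw [← sum_homogeneousComponent q, Finset.mul_sum, map_sum]
  refine Finset.sum_eq_zero fun i _ => ?_
  rw [homogeneousComponent_of_mem (hp.mul (homogeneousComponent_isHomogeneous i q))]
  rw [if_neg (by omega)]

lemma dvd_hc {p : MvPolynomial σ K} {m : ℕ} (hp : p.IsHomogeneous m) {t : MvPolynomial σ K}
    (h : p ∣ t) (d : ℕ) : p ∣ homogeneousComponent d t := by
  obtain ⟨q, rfl⟩ := h
  by_cases hd : d < m
  · rw [hc_mul_lt hp hd]; simp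
  · obtain ⟨e, rfl⟩ := Nat.exists_eq_add_of_le (not_lt.1 hd)
    rw [hc_mul hp]; simp

variable {I J : Type} [Fintype I] [Fintype J]

/-- homogeneous component of a matrix -/
noncomputable def hcM (d : ℕ) (Q : Matrix I J (MvPolynomial σ K)) : Matrix I J (MvPolynomial σ K) :=
  Q.map (homogeneousComponent d)

lemma hcM_add (d : ℕ) (Q Q' : Matrix I J (MvPolynomial σ K)) :
    hcM d (Q + Q') = hcM d Q + hcM d Q' := by
  ext1 i j; simp [hcM]

lemma hcM_hcM (d e : ℕ) (Q : Matrix I J (MvPolynomial σ K)) :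
    hcM d (hcM e Q) = if e = d then hcM d Q else 0 := by
  ext1 i j
  simp only [hcM, Matrix.map_apply]
  rw [homogeneousComponent_of_mem (homogeneousComponent_isHomogeneous e _)]
  by_cases h : e = d
  · subst h; simp
  · simp [h, Ne.symm h]

lemma exists_sum_hcM (Q : Matrix I J (MvPolynomial σ K)) :
    ∃ D, Q = ∑ d ∈ Finset.range D, hcM d Q := by
  refine ⟨(Finset.univ.sup fun i => Finset.univ.sup fun j => (Q i j).totalDegree) + 1, ?_⟩
  ext1 i j
  rw [Matrix.sum_apply]
  simp only [hcM, Matrix.map_apply]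
  conv_lhs => rw [← sum_homogeneousComponent (Q i j)]
  refine Finset.sum_subset ?_ ?_
  · intro d hd
    have h1 := Finset.le_sup (f := fun j => (Q i j).totalDegree) (Finset.mem_univ j)
    have h2 := Finset.le_sup (f := fun i => Finset.univ.sup fun j => (Q i j).totalDegree)
      (Finset.mem_univ i)
    simp only [Finset.mem_range] at *
    omega
  · intro d _ hd
    simp only [Finset.mem_range] at hd
    exact homogeneousComponent_eq_zero _ _ (by omega)

/-- graded Nakayama -/
lemma graded_nakayama (s : σ) (N B : Set (Matrix I J (MvPolynomial σ K)))
    (hB : ∀ Q ∈ B, ∀ d, hcM d Q ∈ B)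
    (hB0 : 0 ∈ B) (hBadd : ∀ Q ∈ B, ∀ Q' ∈ B, Q + Q' ∈ B)
    (hBX : ∀ Q ∈ B, (X s : MvPolynomial σ K) • Q ∈ B)
    (h : ∀ Q ∈ N, ∃ b ∈ B, ∃ Q' ∈ N, Q = b + (X s : MvPolynomial σ K) • Q') :
    ∀ Q ∈ N, Q ∈ B := by
  have key : ∀ d, ∀ Q ∈ N, hcM d Q ∈ B := by
    intro d
    induction d with
    | zero =>
      intro Q hQ
      obtain ⟨b, hb, Q', hQ', rfl⟩ := h Q hQ
      have : hcM 0 ((X s : MvPolynomial σ K) • Q') = 0 := by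
        ext1 i j
        simp only [hcM, Matrix.map_apply, Matrix.smul_apply, smul_eq_mul]
        rw [hc_mul_lt (isHomogeneous_X K s) (by norm_num)]; rfl
      rw [hcM_add, this, add_zero]
      exact hB b hb 0
    | succ d ih =>
      intro Q hQ
      obtain ⟨b, hb, Q', hQ', rfl⟩ := h Q hQ
      have : hcM (d+1) ((X s : MvPolynomial σ K) • Q') = (X s : MvPolynomial σ K) • hcM d Q' := by
        ext1 i j
        simp only [hcM, Matrix.map_apply, Matrix.smul_apply, smul_eq_mul]
        rw [add_comm, hc_mul (isHomogeneous_X K s)]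
      rw [hcM_add, this]
      exact hBadd _ (hB b hb _) _ (hBX _ (ih _ hQ'))
  intro Q hQ
  obtain ⟨D, hD⟩ := exists_sum_hcM Q
  rw [hD]
  exact Finset.sum_induction _ (· ∈ B) (fun a b ha hb => hBadd a ha b hb) hB0
    (fun d _ => key d Q hQ)

end Kill

section Homog
set_option linter.unusedSectionVars false
universe u
variable {K : Type u} [Field K] {σ : Type} {V : Type} [Fintype V] [DecidableEq V]

lemma det_homog (M : Matrix V V (MvPolynomial σ K)) (n : V → ℕ)
    (h : ∀ i j, (M i j).IsHomogeneous (n i)) : M.det.IsHomogeneous (∑ i, n i) := by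
  rw [← Matrix.det_transpose, Matrix.det_apply]
  refine IsHomogeneous.sum _ _ _ fun p _ => ?_
  have : (∏ i, M.transpose (p i) i).IsHomogeneous (∑ i, n i) :=
    IsHomogeneous.prod _ _ _ fun i _ => h i (p i)
  rcases Int.units_eq_one_or (Equiv.Perm.sign p) with h1 | h1
  · rw [h1, one_smul]; exact this
  · rw [h1, Units.neg_smul, one_smul]
    exact (homogeneousSubmodule σ K _).neg_mem this

end Homog


section Edge
set_option linter.unusedSectionVars false
universe u
variable {K : Type u} [Field K] {σ : Type} {V : Type} [Fintype V] [DecidableEq V]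

lemma dvd_of_dvd_X_mul {D t : MvPolynomial σ K} {s : σ} (hD : ¬ X s ∣ D) (h : D ∣ X s * t) :
    D ∣ t := by
  obtain ⟨c, hc⟩ := h
  have : X s ∣ D * c := ⟨t, hc.symm⟩
  rcases (prime_X' s).dvd_or_dvd this with h1 | ⟨e, rfl⟩
  · exact absurd h1 hD
  · refine ⟨e, mul_left_cancel₀ (X_ne_zero s) ?_⟩
    rw [hc]; ring

lemma E_of_mod {M : Matrix V V (MvPolynomial σ K)} (hM : M.transpose = M)
    (hh : ∀ i j, (M i j).IsHomogeneous 1) (s : σ) (hs : ¬ X s ∣ M.det)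
    (step : ∀ Q : Matrix V V (MvPolynomial σ K), M.det ∣ (Q * M.adjugate).trace →
      ∃ C, ∃ A ∈ altMat (MvPolynomial σ K) V, ∃ Q', Q = M * C + A + (X s : MvPolynomial σ K) • Q')
    (Q : Matrix V V (MvPolynomial σ K)) (hQ : M.det ∣ (Q * M.adjugate).trace) :
    ∃ C, ∃ A ∈ altMat (MvPolynomial σ K) V, Q = M * C + A := by
  refine graded_nakayama s {Q : Matrix V V (MvPolynomial σ K) | M.det ∣ (Q * M.adjugate).trace}
    {Q | ∃ C, ∃ A ∈ altMat (MvPolynomial σ K) V, Q = M * C + A} ?_ ?_ ?_ ?_ ?_ Q hQ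
  · rintro Q ⟨C, A, hA, rfl⟩ d
    have hAd : hcM d A ∈ altMat (MvPolynomial σ K) V := by
      rw [mem_altMat'] at *
      simp only [hcM, Matrix.map_apply]
      exact ⟨fun i j => by rw [hA.1 i j, map_neg], fun i => by rw [hA.2, map_zero]⟩
    cases d with
    | zero =>
      refine ⟨0, _, hAd, ?_⟩
      rw [hcM_add, Matrix.mul_zero]
      congr 1
      ext1 i j
      simp only [hcM, Matrix.map_apply, Matrix.mul_apply, map_sum]
      exact Finset.sum_eq_zero fun k _ => hc_mul_lt (hh i k) (by norm_num) _
    | succ d =>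
      refine ⟨hcM d C, _, hAd, ?_⟩
      rw [hcM_add]
      congr 1
      ext1 i j
      simp only [hcM, Matrix.map_apply, Matrix.mul_apply, map_sum]
      refine Finset.sum_congr rfl fun k _ => ?_
      rw [add_comm, hc_mul (hh i k)]
  · exact ⟨0, 0, zero_mem _, by simp⟩
  · rintro _ ⟨C, A, hA, rfl⟩ _ ⟨C', A', hA', rfl⟩
    exact ⟨C + C', A + A', add_mem hA hA', by rw [Matrix.mul_add]; abel⟩
  · rintro _ ⟨C, A, hA, rfl⟩
    refine ⟨(X s : MvPolynomial σ K) • C, (X s : MvPolynomial σ K) • A,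
      Submodule.smul_mem _ _ hA, ?_⟩
    rw [Matrix.mul_smul, smul_add]
  · intro Q hQ
    obtain ⟨C, A, hA, Q', rfl⟩ := step Q hQ
    refine ⟨_, ⟨C, A, hA, rfl⟩, Q', ?_, rfl⟩
    simp only [Set.mem_ofPred_eq] at hQ ⊢
    rw [Matrix.add_mul, Matrix.trace_add, trace_XC M C A hM hA, Matrix.smul_mul,
      Matrix.trace_smul, smul_eq_mul] at hQ
    exact dvd_of_dvd_X_mul hs ((dvd_add_right (Dvd.intro_left _ rfl)).1 hQ)

lemma H_of_mod {D P : MvPolynomial σ K} {m : ℕ} (hD : D.IsHomogeneous m) (s : σ) (hs : ¬ X s ∣ D)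
    (step : ∀ d, D ∣ P * d → ∃ c e, d = D * c + X s * e) (d : MvPolynomial σ K) (hd : D ∣ P * d) :
    D ∣ d := by
  have := graded_nakayama (I := Unit) (J := Unit) s {Q | D ∣ P * Q () ()} {Q | D ∣ Q () ()}
    ?_ ?_ ?_ ?_ ?_ (fun _ _ => d) hd
  · exact this
  · intro Q hQ d
    exact dvd_hc hD hQ d
  · exact dvd_zero _
  · intro Q hQ Q' hQ'
    exact dvd_add hQ hQ'
  · intro Q hQ
    exact Dvd.dvd.mul_left hQ _
  · intro Q hQ
    obtain ⟨c, e, hce⟩ := step _ hQ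
    refine ⟨fun _ _ => D * c, Dvd.intro _ rfl, fun _ _ => e, ?_, ?_⟩
    · simp only [Set.mem_ofPred_eq] at hQ ⊢
      rw [hce, mul_add] at hQ
      have h2 := (dvd_add_right (a := D) (b := P * (D * c)) ⟨P * c, by ring⟩).1 hQ
      refine dvd_of_dvd_X_mul hs ?_
      convert h2 using 1; ring
    · ext1 i j
      exact hce

lemma kill_det (s : σ) (M : Matrix V V (MvPolynomial σ K)) :
    kill s M.det = (M.map (kill s)).det := AlgHom.map_det _ _

lemma kill_adj (s : σ) (M : Matrix V V (MvPolynomial σ K)) :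
    M.adjugate.map (kill s) = (M.map (kill s)).adjugate := AlgHom.map_adjugate _ _

lemma exists_eq_killM {I J : Type} (s : σ) (Q : Matrix I J (MvPolynomial σ K)) :
    ∃ Q', Q = Q.map (kill s) + (X s : MvPolynomial σ K) • Q' := by
  choose q hq using fun i j => exists_eq_kill s (Q i j)
  exact ⟨Matrix.of q, by ext1 i j; exact hq i j⟩

/-- adding an edge variable -/
lemma GoodMat.of_kill {M : Matrix V V (MvPolynomial σ K)} (hM : M.transpose = M)
    (hh : ∀ i j, (M i j).IsHomogeneous 1) (s : σ) (hg : GoodMat (M.map (kill s))) :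
    GoodMat M := by
  have hs : ¬ X s ∣ M.det := by
    rw [X_dvd_iff_kill, kill_det]; exact hg.det_ne
  have hdet : ∃ q, M.det = (M.map (kill s)).det + X s * q := by
    rw [← kill_det]; exact exists_eq_kill _ _
  obtain ⟨q, hq⟩ := hdet
  refine ⟨hM, ?_, ?_, ?_, ?_⟩
  · intro h; rw [h] at hs; simp at hs
  · intro u w h
    apply hg.adj_ne u w
    rw [← kill_adj]; simp [h]
  · intro u d hd
    refine H_of_mod (det_homog M (fun _ => 1) hh) s hs ?_ d hd
    intro d hd
    have h1 := map_dvd (kill s) hd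
    rw [map_mul, kill_det] at h1
    have h2 : kill s (M.adjugate u u) = (M.map (kill s)).adjugate u u := by
      rw [← kill_adj]; rfl
    rw [h2] at h1
    obtain ⟨c, hc⟩ := hg.H u _ h1
    obtain ⟨e, he⟩ := exists_eq_kill s d
    refine ⟨c, e - q * c, ?_⟩
    rw [hc] at he
    rw [hq, he]
    ring
  · refine E_of_mod hM hh s hs ?_
    intro Q hQ
    have h1 := map_dvd (kill s) hQ
    rw [kill_det] at h1
    have h2 : kill s (Q * M.adjugate).trace = (Q.map (kill s) * (M.map (kill s)).adjugate).trace := by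
      rw [← kill_adj]
      simp [Matrix.trace, Matrix.mul_apply]
    rw [h2] at h1
    obtain ⟨C, A, hA, hCA⟩ := hg.E _ h1
    obtain ⟨Q', hQ'⟩ := exists_eq_killM s Q
    obtain ⟨M', hM'⟩ := exists_eq_killM s M
    refine ⟨C, A, hA, Q' - M' * C, ?_⟩
    have h3 : M * C = M.map (kill s) * C + (X s : MvPolynomial σ K) • (M' * C) := by
      conv_lhs => rw [hM']
      rw [Matrix.add_mul, Matrix.smul_mul]
    rw [h3, smul_sub]
    conv_lhs => rw [hQ', hCA]
    abel

end Edge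


section LeafAlg
set_option linter.unusedSectionVars false
universe u
variable {R : Type u} [CommRing R] [IsDomain R] {W : Type} [Fintype W] [DecidableEq W]

/-- bordered matrix with a leaf attached at `u` -/
def leafMat (a x : R) (u : W) (M : Matrix W W R) : Matrix (Unit ⊕ W) (Unit ⊕ W) R :=
  Matrix.fromBlocks (Matrix.of fun _ _ => a) (Matrix.of fun _ j => if j = u then x else 0)
    (Matrix.of fun i _ => if i = u then x else 0) M

variable {a x : R} {u : W} {M : Matrix W W R}

@[simp] lemma leafMat_ll (i j : Unit) : leafMat a x u M (Sum.inl i) (Sum.inl j) = a := rfl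
@[simp] lemma leafMat_lr (i : Unit) (j : W) :
    leafMat a x u M (Sum.inl i) (Sum.inr j) = if j = u then x else 0 := rfl
@[simp] lemma leafMat_rl (i : W) (j : Unit) :
    leafMat a x u M (Sum.inr i) (Sum.inl j) = if i = u then x else 0 := rfl
@[simp] lemma leafMat_rr (i j : W) : leafMat a x u M (Sum.inr i) (Sum.inr j) = M i j := rfl

lemma leaf_symm (hM : M.transpose = M) : (leafMat a x u M).transpose = leafMat a x u M := by
  rw [leafMat, Matrix.fromBlocks_transpose, hM]
  rfl

lemma leaf_det (h0 : M.det ≠ 0) :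
    (leafMat a x u M).det = a * M.det - x ^ 2 * M.adjugate u u := by
  have h1 : leafMat a x u M * Matrix.fromBlocks (Matrix.of fun _ _ => M.det) 0
      (Matrix.of fun i _ => - x * M.adjugate i u) 1 =
      Matrix.fromBlocks (Matrix.of fun _ _ => a * M.det - x ^ 2 * M.adjugate u u)
        (Matrix.of fun _ j => if j = u then x else 0) 0 M := by
    rw [leafMat, Matrix.fromBlocks_multiply]
    congr 1
    · ext i j
      simp [Matrix.mul_apply]
      ring
    · simp
    · ext i j
      have h2 : (M * M.adjugate) i u = if i = u then M.det else 0 := by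
        rw [Matrix.mul_adjugate]; simp [Matrix.one_apply]
      have h3 : (M * Matrix.of fun i (_ : Unit) => -x * M.adjugate i u) i j = - x * (M * M.adjugate) i u := by
        simp only [Matrix.mul_apply, Finset.mul_sum, Matrix.of_apply]
        exact Finset.sum_congr rfl fun k _ => by ring
      rw [Matrix.add_apply, h3, h2]
      simp only [Matrix.mul_apply]
      by_cases h : i = u <;> simp [h]
    · simp
  have h2 := congrArg Matrix.det h1
  rw [Matrix.det_mul, Matrix.det_fromBlocks_zero₁₂, Matrix.det_fromBlocks_zero₂₁] at h2
  simp only [Matrix.det_unique, Matrix.det_one, mul_one] at h2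
  exact mul_right_cancel₀ h0 h2

lemma leaf_row (w : W) (k : Unit ⊕ W) :
    M.det * (leafMat a x u M).adjugate (Sum.inr w) k =
     (∑ j, M.adjugate w j * ((leafMat a x u M).det * if (Sum.inr j) = k then 1 else 0)) -
      x * M.adjugate w u * (leafMat a x u M).adjugate (Sum.inl ()) k := by
  set P := (leafMat a x u M).adjugate with hP
  have h1 : ∀ i, (∑ j, M i j * P (Sum.inr j) k) =
      ((leafMat a x u M).det * if (Sum.inr i) = k then 1 else 0) -
      (if i = u then x else 0) * P (Sum.inl ()) k := by
    intro i
    have : (leafMat a x u M * P) (Sum.inr i) k =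
        (leafMat a x u M).det * if (Sum.inr i) = k then 1 else 0 := by
      rw [hP, Matrix.mul_adjugate]; simp [Matrix.one_apply]
    rw [← this, Matrix.mul_apply, Fintype.sum_sum_type]
    simp
  have h2 : ∑ i, M.adjugate w i * (∑ j, M i j * P (Sum.inr j) k) = M.det * P (Sum.inr w) k := by
    have : M.adjugate.mulVec (M.mulVec (fun j => P (Sum.inr j) k)) w = M.det * P (Sum.inr w) k := by
      rw [Matrix.mulVec_mulVec, Matrix.adjugate_mul, Matrix.smul_mulVec, Matrix.one_mulVec]; rfl
    exact this
  rw [← h2]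
  simp only [h1, mul_sub, Finset.sum_sub_distrib]
  congr 1
  simp
  ring

lemma leaf_adj_ll (h0 : M.det ≠ 0) (hd : (leafMat a x u M).det ≠ 0) : (leafMat a x u M).adjugate (Sum.inl ()) (Sum.inl ()) = M.det := by
  have h1 := leaf_row (a := a) (x := x) (u := u) (M := M) u (Sum.inl ())
  have h2 : (leafMat a x u M * (leafMat a x u M).adjugate) (Sum.inl ()) (Sum.inl ()) =
    (leafMat a x u M).det := by rw [Matrix.mul_adjugate]; simp
  rw [Matrix.mul_apply, Fintype.sum_sum_type] at h2
  simp at h2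
  simp at h1
  change a * (leafMat a x u M).adjugate (Sum.inl ()) (Sum.inl ()) +
    x * (leafMat a x u M).adjugate (Sum.inr u) (Sum.inl ()) = (leafMat a x u M).det at h2
  apply mul_left_cancel₀ hd
  have h3 := leaf_det (a := a) (x := x) (u := u) h0
  linear_combination M.det * h2 - x * h1 +
    (leafMat a x u M).adjugate (Sum.inl ()) (Sum.inl ()) * h3

lemma leaf_adj_rl (h0 : M.det ≠ 0) (hd : (leafMat a x u M).det ≠ 0) (w : W) :
    (leafMat a x u M).adjugate (Sum.inr w) (Sum.inl ()) = - x * M.adjugate w u := by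
  have h1 := leaf_row (a := a) (x := x) (u := u) (M := M) w (Sum.inl ())
  rw [leaf_adj_ll h0 hd] at h1
  simp at h1
  apply mul_left_cancel₀ h0
  linear_combination h1

lemma leaf_adj_lr (h0 : M.det ≠ 0) (hd : (leafMat a x u M).det ≠ 0) (hM : M.transpose = M) (w : W) :
    (leafMat a x u M).adjugate (Sum.inl ()) (Sum.inr w) = - x * M.adjugate u w := by
  have h := congrFun (congrFun (adj_symm (leaf_symm (a := a) (x := x) (u := u) hM)) (Sum.inr w))
    (Sum.inl ())
  have h2 := congrFun (congrFun (adj_symm hM) u) w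
  rw [Matrix.transpose_apply] at h h2
  rw [h, leaf_adj_rl h0 hd, h2]

lemma leaf_adj_rr (h0 : M.det ≠ 0) (hd : (leafMat a x u M).det ≠ 0) (hM : M.transpose = M) (w w' : W) :
    M.det * (leafMat a x u M).adjugate (Sum.inr w) (Sum.inr w') =
      (leafMat a x u M).det * M.adjugate w w' + x ^ 2 * (M.adjugate w u * M.adjugate u w') := by
  rw [leaf_row, leaf_adj_lr h0 hd hM]
  simp
  ring

lemma leaf_trace (h0 : M.det ≠ 0) (hd : (leafMat a x u M).det ≠ 0) (hM : M.transpose = M) (Q : Matrix (Unit ⊕ W) (Unit ⊕ W) R) :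
    (Q * (leafMat a x u M).adjugate).trace = Q (Sum.inl ()) (Sum.inl ()) * M.det
      - x * (M.adjugate.mulVec (fun w => Q (Sum.inl ()) (Sum.inr w) + Q (Sum.inr w) (Sum.inl ()))) u
      + (Q.toBlocks₂₂ * (leafMat a x u M).adjugate.toBlocks₂₂).trace := by
  have h2 : ∀ w, M.adjugate w u = M.adjugate u w := fun w => congrFun (congrFun (adj_symm hM) u) w
  simp only [Matrix.trace, Matrix.diag_apply, Matrix.mul_apply, Fintype.sum_sum_type,
    Matrix.mulVec, dotProduct, Matrix.toBlocks₂₂, Matrix.of_apply, Finset.univ_unique,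
    Finset.sum_singleton, leaf_adj_rl h0 hd, leaf_adj_lr h0 hd hM, PUnit.default_eq_unit,
    leaf_adj_ll h0 hd, Finset.sum_add_distrib, h2, Finset.mul_sum, mul_add]
  have h3 : ∀ f : W → R, ∑ w, f w * (-x * M.adjugate u w) = - ∑ w, x * (M.adjugate u w * f w) := by
    intro f; rw [← Finset.sum_neg_distrib]; exact Finset.sum_congr rfl fun _ _ => by ring
  rw [h3 (fun w => Q (Sum.inl ()) (Sum.inr w)), h3 (fun w => Q (Sum.inr w) (Sum.inl ()))]
  ring

end LeafAlg


section Leaf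
set_option linter.unusedSectionVars false
universe u
variable {K : Type u} [Field K] {σ : Type} {W : Type} [Fintype W] [DecidableEq W]

lemma H_of_irred {D P : MvPolynomial σ K} (hD : D ≠ 0)
    (h : ∀ p, Irreducible p → p ∣ D → p ∣ P → False) (d : MvPolynomial σ K) (hd : D ∣ P * d) :
    D ∣ d := by
  have : IsRelPrime D P := WfDvdMonoid.isRelPrime_of_no_irreducible_factors
    (fun h => hD h.1) (fun p hp h1 h2 => h p hp h1 h2)
  exact this.dvd_of_dvd_mul_left hd

lemma irred_of_H {D P : MvPolynomial σ K} (hD : D ≠ 0) (H : ∀ d, D ∣ P * d → D ∣ d)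
    {p : MvPolynomial σ K} (hp : Irreducible p) (h1 : p ∣ D) (h2 : p ∣ P) : False := by
  obtain ⟨c, rfl⟩ := h1
  obtain ⟨e, rfl⟩ := h2
  obtain ⟨f, hf⟩ := H c ⟨e, by ring⟩
  apply hp.not_isUnit
  have hc : c ≠ 0 := right_ne_zero_of_mul hD
  exact IsUnit.of_mul_eq_one f (mul_left_cancel₀ hc (by rw [mul_one]; conv_rhs => rw [hf]
                                                        ring))

lemma X_dvd_of_dvd_X {p : MvPolynomial σ K} (hp : Irreducible p) {s : σ} (h : p ∣ X s) :
    X s ∣ p := (Irreducible.dvd_symm hp (prime_X' s).irreducible h)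

variable {M : Matrix W W (MvPolynomial σ K)} {a s : σ}

lemma kill_det_self (hs : ∀ i j, kill s (M i j) = M i j) : kill s M.det = M.det := by
  rw [kill_det]; congr 1; ext1 i j; exact hs i j

lemma kill_adj_self (hs : ∀ i j, kill s (M i j) = M i j) (i j : W) :
    kill s (M.adjugate i j) = M.adjugate i j := by
  have h1 := congrFun (congrFun (kill_adj s M) i) j
  have h2 : M.map (kill s) = M := by ext1 i j; exact hs i j
  rw [h2] at h1
  exact h1

lemma leaf_kill_det (hg : GoodMat M) (has : a ≠ s)
    (ha : ∀ i j, kill a (M i j) = M i j) (hs : ∀ i j, kill s (M i j) = M i j) (u : W)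
    : kill s (leafMat (X a) (X s) u M).det = X a * M.det := by
  rw [leaf_det hg.det_ne, map_sub, map_mul, map_mul, map_pow, kill_X_self, kill_X_ne has,
    kill_det_self hs]
  simp

lemma leaf_not_dvd (hg : GoodMat M) (has : a ≠ s)
    (ha : ∀ i j, kill a (M i j) = M i j) (hs : ∀ i j, kill s (M i j) = M i j) (u : W)
    : ¬ X s ∣ (leafMat (X a) (X s) u M).det := by
  rw [X_dvd_iff_kill, leaf_kill_det hg has ha hs]
  exact mul_ne_zero (X_ne_zero a) hg.det_ne

lemma leaf_det_ne (hg : GoodMat M) (has : a ≠ s)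
    (ha : ∀ i j, kill a (M i j) = M i j) (hs : ∀ i j, kill s (M i j) = M i j) (u : W)
    : (leafMat (X a) (X s) u M).det ≠ 0 := by
  intro h
  apply leaf_not_dvd hg has ha hs u
  rw [h]; simp

lemma leaf_kill_adj (hg : GoodMat M) (has : a ≠ s)
    (ha : ∀ i j, kill a (M i j) = M i j) (hs : ∀ i j, kill s (M i j) = M i j) (u : W)
    (w w' : W) : kill s ((leafMat (X a) (X s) u M).adjugate (Sum.inr w) (Sum.inr w'))
    = X a * M.adjugate w w' := by
  have h := congrArg (kill s) (leaf_adj_rr hg.det_ne (leaf_det_ne hg has ha hs u) hg.symm w w')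
  rw [map_mul, map_add, map_mul, map_mul, leaf_kill_det hg has ha hs, kill_det_self hs,
    map_pow, kill_X_self, kill_adj_self hs] at h
  apply mul_left_cancel₀ hg.det_ne
  rw [h]; ring

lemma leaf_H_inl (hg : GoodMat M) (has : a ≠ s)
    (ha : ∀ i j, kill a (M i j) = M i j) (hs : ∀ i j, kill s (M i j) = M i j) (u : W)
    {p : MvPolynomial σ K} (hp : Irreducible p)
    (h1 : p ∣ (leafMat (X a) (X s) u M).det)
    (h2 : p ∣ (leafMat (X a) (X s) u M).adjugate (Sum.inl ()) (Sum.inl ())) : False := by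
  have hpX : ¬ p ∣ X s := fun h =>
    leaf_not_dvd hg has ha hs u ((X_dvd_of_dvd_X hp h).trans h1)
  rw [leaf_adj_ll hg.det_ne (leaf_det_ne hg has ha hs u)] at h2
  rw [leaf_det hg.det_ne] at h1
  have h3 := (dvd_sub_right (h2.mul_left (X a))).1 h1
  rcases hp.prime.dvd_or_dvd h3 with h4 | h4
  · exact hpX (hp.prime.dvd_of_dvd_pow h4)
  · exact irred_of_H hg.det_ne (hg.H u) hp h2 h4

lemma leaf_H_inr (hg : GoodMat M) (has : a ≠ s)
    (ha : ∀ i j, kill a (M i j) = M i j) (hs : ∀ i j, kill s (M i j) = M i j) (u : W)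
    {p : MvPolynomial σ K} (hp : Irreducible p) (w : W)
    (h1 : p ∣ (leafMat (X a) (X s) u M).det)
    (h2 : p ∣ (leafMat (X a) (X s) u M).adjugate (Sum.inr w) (Sum.inr w)) : False := by
  have hd := leaf_det_ne hg has ha hs u
  have hpX : ¬ p ∣ X s := fun h =>
    leaf_not_dvd hg has ha hs u ((X_dvd_of_dvd_X hp h).trans h1)
  have h3 := adj_minor_dvd (leaf_symm (a := X a) (x := X s) (u := u) hg.symm) (v := Sum.inl ())
    (H_of_irred hd fun p hp => leaf_H_inl hg has ha hs u hp) (Sum.inr w)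
  have h4 := (dvd_sub_right (h2.mul_left _)).1 (h1.trans h3)
  have h5 : p ∣ (leafMat (X a) (X s) u M).adjugate (Sum.inl ()) (Sum.inr w) :=
    (hp.prime.dvd_or_dvd h4).elim id id
  rw [leaf_adj_lr hg.det_ne hd hg.symm] at h5
  have h6 : p ∣ M.adjugate u w := by
    rcases hp.prime.dvd_or_dvd h5 with h | h
    · exact absurd ((dvd_neg).1 h) hpX
    · exact h
  have hpa : kill a p = p := kill_of_dvd h6 (hg.adj_ne u w) (kill_adj_self ha u w)
  have h7 := map_dvd (kill a) h1
  rw [leaf_det hg.det_ne, hpa, map_sub, map_mul, map_mul, map_pow, kill_X_self,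
    kill_X_ne has.symm, kill_adj_self ha, zero_mul, zero_sub, dvd_neg] at h7
  have h8 : p ∣ M.adjugate u u := by
    rcases hp.prime.dvd_or_dvd h7 with h | h
    · exact absurd (hp.prime.dvd_of_dvd_pow h) hpX
    · exact h
  rw [leaf_det hg.det_ne] at h1
  have h9 := (dvd_sub_left (h8.mul_left (X s ^ 2))).1 h1
  rcases hp.prime.dvd_or_dvd h9 with h | h
  · have := X_dvd_of_dvd_X hp h
    rw [X_dvd_iff_kill, hpa] at this
    exact hp.ne_zero this
  · exact irred_of_H hg.det_ne (hg.H u) hp h h8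

end Leaf


section LeafE
set_option linter.unusedSectionVars false
universe u
variable {K : Type u} [Field K] {σ : Type} {W : Type} [Fintype W] [DecidableEq W]
variable {M : Matrix W W (MvPolynomial σ K)} {a s : σ}

lemma leaf_E_step2 (hg : GoodMat M) (has : a ≠ s)
    (ha : ∀ i j, kill a (M i j) = M i j) (hs : ∀ i j, kill s (M i j) = M i j) (u : W)
    (Q : Matrix (Unit ⊕ W) (Unit ⊕ W) (MvPolynomial σ K))
    (hQ : (leafMat (X a) (X s) u M).det ∣ (Q * (leafMat (X a) (X s) u M).adjugate).trace)
    (h1 : X s ∣ Q (Sum.inl ()) (Sum.inl ()))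
    (h2 : ∀ i j, X s ∣ Q (Sum.inr i) (Sum.inr j)) :
    ∃ C, ∃ A ∈ altMat (MvPolynomial σ K) (Unit ⊕ W), ∃ Q',
      Q = leafMat (X a) (X s) u M * C + A + (X s : MvPolynomial σ K) • Q' := by
  have hd := leaf_det_ne hg has ha hs u
  obtain ⟨α, hα⟩ := h1
  choose q hq using h2
  set l : W → MvPolynomial σ K := fun w => Q (Sum.inl ()) (Sum.inr w) + Q (Sum.inr w) (Sum.inl ())
    with hl
  choose l₂ hl₂ using fun w => exists_eq_kill s (l w)
  choose l₁ hl₁ using fun w => exists_eq_kill a (kill s (l w))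
  have h3 : Q.toBlocks₂₂ = (X s : MvPolynomial σ K) • Matrix.of q := by
    ext1 i j; exact hq i j
  rw [leaf_trace hg.det_ne hd hg.symm, hα, h3, Matrix.smul_mul, Matrix.trace_smul,
    smul_eq_mul] at hQ
  have h4 := dvd_of_dvd_X_mul (leaf_not_dvd hg has ha hs u)
    (t := α * M.det - M.adjugate.mulVec l u +
      (Matrix.of q * (leafMat (X a) (X s) u M).adjugate.toBlocks₂₂).trace)
    (by convert hQ using 1; ring)
  have h5 := map_dvd (kill a) (map_dvd (kill s) h4)
  rw [leaf_kill_det hg has ha hs, map_mul, kill_X_self, zero_mul, zero_dvd_iff] at h5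
  have h6 : kill a (kill s ((Matrix.of q * (leafMat (X a) (X s) u M).adjugate.toBlocks₂₂).trace)) =
      0 := by
    simp only [Matrix.trace, Matrix.diag_apply, Matrix.mul_apply, map_sum, map_mul]
    refine Finset.sum_eq_zero fun i _ => Finset.sum_eq_zero fun j _ => ?_
    have : kill s ((leafMat (X a) (X s) u M).adjugate.toBlocks₂₂ j i) = X a * M.adjugate j i :=
      leaf_kill_adj hg has ha hs u j i
    rw [this]; simp
  have h7 : kill a (kill s (M.adjugate.mulVec l u)) =
      M.adjugate.mulVec (fun w => kill a (kill s (l w))) u := by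
    simp only [Matrix.mulVec, dotProduct, map_sum, map_mul, kill_adj_self hs, kill_adj_self ha]
  rw [map_add, map_add, h6, map_sub, map_sub, h7, map_mul, map_mul, kill_det_self hs,
    kill_det_self ha, add_zero, sub_eq_zero] at h5
  obtain ⟨f, hf⟩ := mem_range_of_adj_dvd hg.det_ne (hg.H u) _ ⟨_, h5.symm.trans (mul_comm _ _)⟩
  refine ⟨Matrix.fromBlocks 0 (Matrix.of fun _ w => l₁ w) (Matrix.of fun w _ => f w) 0,
    Matrix.fromBlocks 0 (Matrix.of fun _ w => Q (Sum.inl ()) (Sum.inr w) - X a * l₁ w)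
      (Matrix.of fun w _ => -(Q (Sum.inl ()) (Sum.inr w) - X a * l₁ w)) 0, ?_,
    Matrix.fromBlocks (Matrix.of fun _ _ => α - f u) 0 (Matrix.of fun w _ => l₂ w)
      (Matrix.of fun i j => q i j - if i = u then l₁ j else 0), ?_⟩
  · rw [mem_altMat']
    constructor
    · rintro (i | i) (j | j) <;> simp
    · rintro (i | i) <;> simp
  · rw [leafMat, Matrix.fromBlocks_multiply, Matrix.fromBlocks_add, Matrix.fromBlocks_smul,
      Matrix.fromBlocks_add]
    conv_lhs => rw [← Matrix.fromBlocks_toBlocks Q]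
    congr 1
    · ext1 i j
      change Q (Sum.inl ()) (Sum.inl ()) = _
      rw [hα]
      simp [Matrix.mul_apply]
      ring
    · ext1 i j
      change Q (Sum.inl ()) (Sum.inr j) = _
      simp [Matrix.mul_apply]
    · ext1 i j
      change Q (Sum.inr i) (Sum.inl ()) = _
      have hf' : kill a (kill s (l i)) = ∑ k, M i k * f k := congrFun hf i
      have h8 := hl₂ i
      rw [hl₁ i, hf'] at h8
      simp only [hl] at h8
      simp [Matrix.mul_apply]
      linear_combination h8
    · ext1 i j
      change Q (Sum.inr i) (Sum.inr j) = _
      rw [hq]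
      simp [Matrix.mul_apply]
      split_ifs <;> ring

lemma leaf_E_step (hg : GoodMat M) (has : a ≠ s)
    (ha : ∀ i j, kill a (M i j) = M i j) (hs : ∀ i j, kill s (M i j) = M i j) (u : W)
    (Q : Matrix (Unit ⊕ W) (Unit ⊕ W) (MvPolynomial σ K))
    (hQ : (leafMat (X a) (X s) u M).det ∣ (Q * (leafMat (X a) (X s) u M).adjugate).trace) :
    ∃ C, ∃ A ∈ altMat (MvPolynomial σ K) (Unit ⊕ W), ∃ Q',
      Q = leafMat (X a) (X s) u M * C + A + (X s : MvPolynomial σ K) • Q' := by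
  have hd := leaf_det_ne hg has ha hs u
  have h1 := map_dvd (kill s) hQ
  have h2 : kill s ((Q.toBlocks₂₂ * (leafMat (X a) (X s) u M).adjugate.toBlocks₂₂).trace) =
      X a * (Q.toBlocks₂₂.map (kill s) * M.adjugate).trace := by
    simp only [Matrix.trace, Matrix.diag_apply, Matrix.mul_apply, map_sum, map_mul, Finset.mul_sum]
    refine Finset.sum_congr rfl fun i _ => Finset.sum_congr rfl fun j _ => ?_
    have : kill s ((leafMat (X a) (X s) u M).adjugate.toBlocks₂₂ j i) = X a * M.adjugate j i :=
      leaf_kill_adj hg has ha hs u j i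
    rw [this, Matrix.map_apply]
    ring
  rw [leaf_trace hg.det_ne hd hg.symm, leaf_kill_det hg has ha hs, map_add, map_sub, map_mul,
    map_mul, kill_X_self, zero_mul, sub_zero, h2, kill_det_self hs] at h1
  have hXa : ¬ X a ∣ M.det := by
    rw [X_dvd_iff_kill, kill_det_self ha]; exact hg.det_ne
  have h3 : X a ∣ kill s (Q (Sum.inl ()) (Sum.inl ())) := by
    have := (dvd_add_left (Dvd.intro _ rfl)).1 ((Dvd.intro _ rfl).trans h1)
    exact ((prime_X' a).dvd_or_dvd this).resolve_right hXa
  obtain ⟨α, hα⟩ := h3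
  rw [hα, mul_assoc, ← mul_add] at h1
  have h4 := (dvd_add_right (Dvd.intro_left _ rfl)).1
    ((mul_dvd_mul_iff_left (X_ne_zero a)).1 h1)
  obtain ⟨C, A, hA, hCA⟩ := hg.E _ h4
  set C₁ : Matrix (Unit ⊕ W) (Unit ⊕ W) (MvPolynomial σ K) :=
    Matrix.fromBlocks (Matrix.of fun _ _ => α) 0 0 C with hC₁
  set A₁ : Matrix (Unit ⊕ W) (Unit ⊕ W) (MvPolynomial σ K) := Matrix.fromBlocks 0 0 0 A with hA₁'
  have hA₁ : A₁ ∈ altMat (MvPolynomial σ K) (Unit ⊕ W) := by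
    rw [mem_altMat'] at *
    constructor
    · rintro (i | i) (j | j)
      · simp [hA₁']
      · simp [hA₁']
      · simp [hA₁']
      · simpa [hA₁'] using hA.1 i j
    · rintro (i | i) <;> simp [hA₁', hA.2]
  have key := leaf_E_step2 hg has ha hs u
    (Q - (leafMat (X a) (X s) u M * C₁ + A₁)) (by
      rw [Matrix.sub_mul, Matrix.trace_sub, trace_XC _ _ _ (leaf_symm hg.symm) hA₁]
      exact dvd_sub hQ (Dvd.intro_left _ rfl)) (by
      obtain ⟨q, hq⟩ := exists_eq_kill s (Q (Sum.inl ()) (Sum.inl ()))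
      refine ⟨q, ?_⟩
      rw [hα] at hq
      rw [leafMat, hC₁, Matrix.fromBlocks_multiply, hA₁', Matrix.fromBlocks_add]
      simp [Matrix.mul_apply]
      rw [hq]; ring) (by
      intro i j
      obtain ⟨q, hq⟩ := exists_eq_kill s (Q (Sum.inr i) (Sum.inr j))
      refine ⟨q, ?_⟩
      have h5 : kill s (Q (Sum.inr i) (Sum.inr j)) = (M * C + A) i j := by rw [← hCA]; rfl
      rw [h5] at hq
      rw [leafMat, hC₁, Matrix.fromBlocks_multiply, hA₁', Matrix.fromBlocks_add]
      rw [Matrix.sub_apply, hq]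
      simp)
  obtain ⟨C₂, A₂, hA₂, Q', hQ'⟩ := key
  refine ⟨C₂ + C₁, A₂ + A₁, add_mem hA₂ hA₁, Q', ?_⟩
  rw [sub_eq_iff_eq_add] at hQ'
  rw [hQ', Matrix.mul_add]
  abel

lemma GoodMat.leaf (hg : GoodMat M) (has : a ≠ s)
    (ha : ∀ i j, kill a (M i j) = M i j) (hs : ∀ i j, kill s (M i j) = M i j) (u : W)
    (hh : ∀ i j, (M i j).IsHomogeneous 1) : GoodMat (leafMat (X a) (X s) u M) := by
  have hd := leaf_det_ne hg has ha hs u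
  refine ⟨leaf_symm hg.symm, hd, ?_, ?_, ?_⟩
  · rintro (i | i) (j | j)
    · rw [leaf_adj_ll hg.det_ne hd]; exact hg.det_ne
    · rw [leaf_adj_lr hg.det_ne hd hg.symm]
      exact mul_ne_zero (neg_ne_zero.2 (X_ne_zero s)) (hg.adj_ne _ _)
    · rw [leaf_adj_rl hg.det_ne hd]
      exact mul_ne_zero (neg_ne_zero.2 (X_ne_zero s)) (hg.adj_ne _ _)
    · intro h
      have := leaf_kill_adj hg has ha hs u i j
      rw [h, map_zero] at this
      exact mul_ne_zero (X_ne_zero a) (hg.adj_ne i j) this.symm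
  · rintro (i | i)
    · exact H_of_irred hd fun p hp => leaf_H_inl hg has ha hs u hp
    · exact H_of_irred hd fun p hp => leaf_H_inr hg has ha hs u hp i
  · refine E_of_mod (leaf_symm hg.symm) ?_ s (leaf_not_dvd hg has ha hs u)
      (leaf_E_step hg has ha hs u)
    rintro (i | i) (j | j)
    · exact isHomogeneous_X K a
    · rw [leafMat_lr]; split_ifs
      · exact isHomogeneous_X K s
      · exact isHomogeneous_zero _ _ _
    · rw [leafMat_rl]; split_ifs
      · exact isHomogeneous_X K s
      · exact isHomogeneous_zero _ _ _
    · exact hh i j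

end LeafE


section Reindex
set_option linter.unusedSectionVars false
universe u
variable {R : Type u} [CommRing R] [IsDomain R] {V V' : Type} [Fintype V] [DecidableEq V]
  [Fintype V'] [DecidableEq V']

lemma trace_submatrix_equiv (e : V' ≃ V) (M : Matrix V V R) :
    (M.submatrix e e).trace = M.trace := by
  simp only [Matrix.trace, Matrix.diag_apply, Matrix.submatrix_apply]
  exact Equiv.sum_comp e (fun i => M i i)

lemma GoodMat.of_reindex (e : V' ≃ V) {M : Matrix V V R} (hg : GoodMat (M.submatrix e e)) :
    GoodMat M := by
  have hdet : (M.submatrix e e).det = M.det := Matrix.det_submatrix_equiv_self e M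
  have hadj : (M.submatrix e e).adjugate = M.adjugate.submatrix e e :=
    Matrix.adjugate_submatrix_equiv_self e M
  have hback : ∀ N : Matrix V V R, (N.submatrix e e).submatrix e.symm e.symm = N := by
    intro N; ext i j; simp
  refine ⟨?_, hdet ▸ hg.det_ne, ?_, ?_, ?_⟩
  · have := congrArg (fun N => N.submatrix e.symm e.symm) hg.symm
    simpa [Matrix.transpose_submatrix, hback] using this
  · intro u w
    have := hg.adj_ne (e.symm u) (e.symm w)
    rw [hadj] at this
    simpa using this
  · intro u d
    have := hg.H (e.symm u) d
    rw [hadj, hdet] at this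
    simpa using this
  · intro Q hQ
    have := hg.E (Q.submatrix e e)
    rw [hadj, hdet, Matrix.submatrix_mul_equiv, trace_submatrix_equiv] at this
    obtain ⟨C, A, hA, h⟩ := this hQ
    refine ⟨C.submatrix e.symm e.symm, A.submatrix e.symm e.symm, ?_, ?_⟩
    · rw [mem_altMat'] at *
      exact ⟨fun i j => hA.1 _ _, fun i => hA.2 _⟩
    · have h2 := congrArg (fun N => N.submatrix e.symm e.symm) h
      simp only [hback] at h2
      rw [h2]
      ext i j
      simp only [Matrix.submatrix_apply, Matrix.add_apply, Matrix.mul_apply]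
      congr 1
      rw [← Equiv.sum_comp e.symm]
      simp

end Reindex

section SymMat
set_option linter.unusedSectionVars false
universe u
variable {K : Type u} [Field K] {σ : Type} {V : Type}

/-- sparse generic symmetric matrix with variables indexed through `ι` -/
noncomputable def symMat (K : Type u) [Field K] {σ : Type} {V : Type} (ι : Sym2 V → σ)
    (G : SimpleGraph V) : Matrix V V (MvPolynomial σ K) :=
  Matrix.of fun i j => if i = j ∨ G.Adj i j then X (ι s(i, j)) else 0

lemma symMat_apply (ι : Sym2 V → σ) (G : SimpleGraph V) (i j : V) :
    symMat K ι G i j = if i = j ∨ G.Adj i j then X (ι s(i, j)) else 0 := rfl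

lemma symMat_symm (ι : Sym2 V → σ) (G : SimpleGraph V) :
    (symMat K ι G).transpose = symMat K ι G := by
  ext1 i j
  rw [Matrix.transpose_apply, symMat_apply, symMat_apply, Sym2.eq_swap]
  simp only [G.adj_comm, eq_comm]

lemma symMat_homog (ι : Sym2 V → σ) (G : SimpleGraph V) (i j : V) :
    (symMat K ι G i j).IsHomogeneous 1 := by
  rw [symMat_apply]
  split_ifs
  · exact isHomogeneous_X K _
  · exact isHomogeneous_zero _ _ _

lemma kill_symMat (ι : Sym2 V → σ) (G : SimpleGraph V) (s : σ)
    (hs : ∀ i j, (i = j ∨ G.Adj i j) → ι s(i, j) ≠ s) (i j : V) :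
    kill s (symMat K ι G i j) = symMat K ι G i j := by
  rw [symMat_apply]
  split_ifs with h
  · exact kill_X_ne (hs i j h)
  · simp

lemma kill_symMat_edge {ι : Sym2 V → σ} (hι : Function.Injective ι) (G : SimpleGraph V)
    (e : Sym2 V) (he : e ∈ G.edgeSet) :
    (symMat K ι G).map (kill (ι e)) = symMat K ι (G.deleteEdges {e}) := by
  ext1 i j
  rw [Matrix.map_apply, symMat_apply, symMat_apply]
  simp only [SimpleGraph.deleteEdges_adj, Set.mem_singleton_iff]
  by_cases hij : i = j
  · subst hij
    have : ι s(i, i) ≠ ι e := by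
      intro h
      have := hι h
      subst this
      exact G.loopless.irrefl i (by simp at he)
    simp [kill_X_ne this]
  · by_cases h : s(i, j) = e
    · subst h
      have : G.Adj i j := he
      simp [hij, this]
    · by_cases h2 : G.Adj i j
      · simp [h2, h, kill_X_ne (fun h' => h (hι h'))]
      · simp [h2, hij]

variable [Fintype V] [DecidableEq V]

lemma GoodMat.mono_graph {ι : Sym2 V → σ} (hι : Function.Injective ι) (G' : SimpleGraph V)
    (hg : GoodMat (symMat K ι G')) :
    ∀ n, ∀ G : SimpleGraph V, G' ≤ G → G.edgeSet.ncard = n → GoodMat (symMat K ι G) := by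
  intro n
  induction n with
  | zero =>
    intro G hG hn
    have : G = ⊥ := by
      rw [Set.ncard_eq_zero (Set.toFinite _)] at hn
      exact SimpleGraph.edgeSet_eq_empty.1 hn
    subst this
    rw [le_bot_iff] at hG
    subst hG
    exact hg
  | succ n ih =>
    intro G hG hn
    by_cases h : G' = G
    · subst h; exact hg
    · have : ∃ e, e ∈ G.edgeSet ∧ e ∉ G'.edgeSet := by
        by_contra! hcon
        exact h (le_antisymm hG (SimpleGraph.edgeSet_subset_edgeSet.1 hcon))
      obtain ⟨e, he, he'⟩ := this
      refine GoodMat.of_kill (symMat_symm ι G) (symMat_homog ι G) (ι e) ?_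
      rw [kill_symMat_edge hι G e he]
      apply ih
      · rw [← SimpleGraph.edgeSet_subset_edgeSet, SimpleGraph.edgeSet_deleteEdges]
        intro f hf
        refine ⟨SimpleGraph.edgeSet_subset_edgeSet.2 hG hf, ?_⟩
        rintro rfl
        exact he' hf
      · rw [SimpleGraph.edgeSet_deleteEdges, Set.ncard_sdiff_singleton_of_mem he, hn]
        rfl

lemma good_of_subsingleton [Subsingleton V] [Nonempty V] (ι : Sym2 V → σ) (G : SimpleGraph V) :
    GoodMat (symMat K ι G) := by
  obtain ⟨v⟩ := ‹Nonempty V›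
  have hadj : (symMat K ι G).adjugate = 1 := Matrix.adjugate_subsingleton _
  have huv : ∀ w : V, w = v := fun w => Subsingleton.elim _ _
  have hdet : (symMat K ι G).det = X (ι s(v, v)) := by
    rw [Matrix.det_eq_elem_of_subsingleton _ v, symMat_apply]; simp
  refine ⟨symMat_symm ι G, ?_, ?_, ?_, ?_⟩
  · rw [hdet]; exact X_ne_zero _
  · intro u w
    rw [hadj, huv u, huv w]; simp
  · intro u d
    rw [hadj]; simp
  · intro Q hQ
    rw [hadj, Matrix.mul_one, hdet] at hQ
    have : Q.trace = Q v v := by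
      rw [Matrix.trace, Finset.sum_eq_single v]
      · rfl
      · intro b _ hb; exact absurd (huv b) hb
      · simp
    rw [this] at hQ
    obtain ⟨c, hc⟩ := hQ
    refine ⟨Matrix.of fun _ _ => c, 0, zero_mem _, ?_⟩
    ext1 i j
    rw [huv i, huv j, hc, add_zero, Matrix.mul_apply, Finset.sum_eq_single v]
    · simp [symMat_apply]
    · intro b _ hb; exact absurd (huv b) hb
    · simp

lemma good_of_connected : ∀ n, ∀ (V : Type) [Fintype V] [DecidableEq V] (ι : Sym2 V → σ) (_ : Function.Injective ι)
    (G : SimpleGraph V), G.Connected → Fintype.card V = n → GoodMat (symMat K ι G) := by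
  intro n
  induction n with
  | zero =>
    intro V _ _ ι hι G hG hn
    have := hG.nonempty
    rw [Fintype.card_eq_zero_iff] at hn
    exact (hn.false this.some).elim
  | succ n ih =>
    intro V _ _ ι hι G hG hn
    have := hG.nonempty
    rcases subsingleton_or_nontrivial V with hV | hV
    · exact good_of_subsingleton ι G
    obtain ⟨v, hv⟩ := hG.exists_connected_induce_compl_singleton_of_finite_nontrivial
    obtain ⟨u, hu⟩ := hG.preconnected.exists_adj_of_nontrivial v
    have huv : u ≠ v := hu.ne'
    let W : Type := ({v}ᶜ : Set V)
    let ι₀ : Sym2 W → σ := ι ∘ Sym2.map Subtype.val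
    have hι₀ : Function.Injective ι₀ := hι.comp (Sym2.map.injective Subtype.val_injective)
    have hcard : Fintype.card W = n := by
      have : Fintype.card W = Fintype.card V - 1 := by
        simp only [W]
        rw [Fintype.card_compl_set]; simp
      omega
    have h0 := ih W ι₀ hι₀ (G.induce {v}ᶜ) hv hcard
    let u₀ : W := ⟨u, huv⟩
    have hne1 : s(v, v) ≠ s(u, v) := by
      simp [huv.symm]
    have hkill : ∀ t : V, ∀ i j : W, kill (ι s(t, v)) (symMat K ι₀ (G.induce {v}ᶜ) i j) =
        symMat K ι₀ (G.induce {v}ᶜ) i j := by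
      intro t
      apply kill_symMat
      intro i j _ h
      have h1 := hι h
      have : v ∈ Sym2.map Subtype.val s(i, j) := by rw [h1]; simp
      simp only [Sym2.map_mk, Sym2.mem_iff] at this
      rcases this with h | h
      · exact i.2 h.symm
      · exact j.2 h.symm
    have h1 := GoodMat.leaf h0 (a := ι s(v, v)) (s := ι s(u, v)) (hι.ne hne1)
      (hkill v) (hkill u) u₀ (symMat_homog _ _)
    let G' : SimpleGraph V := G.deleteEdges {e | v ∈ e ∧ e ≠ s(u, v)}
    have hG'a : ∀ i j, G'.Adj i j ↔ G.Adj i j ∧ ¬ (v ∈ s(i, j) ∧ s(i, j) ≠ s(u, v)) := by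
      intro i j
      exact SimpleGraph.deleteEdges_adj
    refine GoodMat.mono_graph hι G' ?_ _ G (SimpleGraph.deleteEdges_le _) rfl
    let f : Unit ⊕ W → V := Sum.elim (fun _ => v) Subtype.val
    have hf : Function.Bijective f := by
      constructor
      · rintro (i | i) (j | j) h
        · rfl
        · exact absurd h.symm j.2
        · exact absurd h i.2
        · exact congrArg _ (Subtype.ext h)
      · intro w
        by_cases hw : w = v
        · exact ⟨Sum.inl (), hw.symm⟩
        · exact ⟨Sum.inr ⟨w, hw⟩, rfl⟩
    refine GoodMat.of_reindex (Equiv.ofBijective f hf) ?_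
    convert h1 using 1
    ext1 i j
    rw [Matrix.submatrix_apply]
    rcases i with i | i <;> rcases j with j | j
    · simp [f, symMat_apply]
    · rw [leafMat_lr]
      have hj : (j : V) ≠ v := j.2
      have : (j = u₀) ↔ (j : V) = u := Subtype.ext_iff
      simp only [Equiv.ofBijective_apply, f, Sum.elim_inl, Sum.elim_inr, symMat_apply, hG'a, this]
      by_cases hju : (j : V) = u
      · simp [hju, hu, Sym2.eq_swap]
      · have h3 : s(v, (j : V)) ≠ s(u, v) := by
          rw [Ne, Sym2.eq_swap, Sym2.congr_left]; exact hju
        simp [hju, h3, hj.symm]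
    · rw [leafMat_rl]
      have hj : (i : V) ≠ v := i.2
      have : (i = u₀) ↔ (i : V) = u := Subtype.ext_iff
      simp only [Equiv.ofBijective_apply, f, Sum.elim_inl, Sum.elim_inr, symMat_apply, hG'a, this]
      by_cases hju : (i : V) = u
      · simp [hju, hu.symm]
      · have h3 : s((i : V), v) ≠ s(u, v) := by
          rw [Ne, Sym2.congr_left]; exact hju
        simp [hju, h3, hj]
    · rw [leafMat_rr]
      have hi : (i : V) ≠ v := i.2
      have hj : (j : V) ≠ v := j.2
      simp only [Equiv.ofBijective_apply, f, Sum.elim_inr, symMat_apply, hG'a]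
      have h4 : (i : V) = j ↔ i = j := Subtype.ext_iff.symm
      simp [hi.symm, hj.symm, h4, ι₀]

end SymMat


section Disc
set_option linter.unusedSectionVars false
universe u

lemma PdLT.ideal_sum {R : Type u} [CommRing R] [IsDomain R] {J₁ J₂ I : Ideal R} {α β : R}
    (hα : α ∈ J₁) (hβ : β ∈ J₂) (hα0 : α ≠ 0) (hrel : ∀ p, α ∣ β * p → α ∣ p)
    (h1 : ∀ p ∈ J₁, β * p ∈ I) (h2 : ∀ q ∈ J₂, α * q ∈ I)
    (h3 : ∀ y ∈ I, ∃ p ∈ J₁, ∃ q ∈ J₂, y = β * p + α * q) {n : ℕ}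
    (hJ₁ : PdLT R J₁ (n + 2)) (hJ₂ : PdLT R J₂ (n + 2)) : PdLT R I (n + 2) := by
  let g₀ : J₁ × J₂ →ₗ[R] R :=
    LinearMap.coprod ((LinearMap.mulLeft R β).comp J₁.subtype)
      ((LinearMap.mulLeft R α).comp J₂.subtype)
  have hg₀ : ∀ p, g₀ p = β * p.1.1 + α * p.2.1 := fun p => rfl
  let g : J₁ × J₂ →ₗ[R] I := g₀.codRestrict I (fun p => by
    rw [hg₀]; exact add_mem (h1 _ p.1.2) (h2 _ p.2.2))
  have hgs : Function.Surjective g := by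
    rintro ⟨y, hy⟩
    obtain ⟨p, hp, q, hq, rfl⟩ := h3 y hy
    exact ⟨(⟨p, hp⟩, ⟨q, hq⟩), rfl⟩
  have hgker : ∀ p, p ∈ LinearMap.ker g ↔ β * p.1.1 + α * p.2.1 = 0 := by
    intro p
    rw [LinearMap.mem_ker, Subtype.ext_iff]
    rfl
  refine PdLT.of_ker g hgs ?_ (PdLT.prod hJ₁ hJ₂)
  let k₀ : R →ₗ[R] J₁ × J₂ := LinearMap.prod (LinearMap.toSpanSingleton R J₁ ⟨α, hα⟩)
    (-(LinearMap.toSpanSingleton R J₂ ⟨β, hβ⟩))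
  have hk1 : ∀ r, (k₀ r).1.1 = r * α := fun r => rfl
  have hk2 : ∀ r, (k₀ r).2.1 = -(r * β) := fun r => rfl
  let k : R →ₗ[R] LinearMap.ker g := k₀.codRestrict _ (fun r => by
    rw [hgker, hk1, hk2]; ring)
  have hk : Function.Bijective k := by
    constructor
    · intro r r' h
      have : r * α = r' * α := congrArg (fun t : LinearMap.ker g => t.1.1.1) h
      exact mul_right_cancel₀ hα0 this
    · rintro ⟨⟨⟨p, hp⟩, ⟨q, hq⟩⟩, h⟩
      rw [hgker] at h
      dsimp only at h
      obtain ⟨r, rfl⟩ := hrel p ⟨-q, by linear_combination h⟩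
      refine ⟨r, Subtype.ext (Prod.ext (Subtype.ext ?_) (Subtype.ext ?_))⟩
      · change r * α = α * r; ring
      · change -(r * β) = q
        apply mul_left_cancel₀ hα0
        linear_combination -h
  exact PdLT.mono (PdLT.of_equiv (LinearEquiv.ofBijective k hk) PdLT.of_projective) (by omega)

variable {R : Type u} [CommRing R] [IsDomain R] {V V' : Type} [Fintype V] [DecidableEq V]
  [Fintype V'] [DecidableEq V']

lemma adjIdeal_reindex (e : V' ≃ V) (M : Matrix V V R) :
    adjIdeal (M.submatrix e e) = adjIdeal M := by
  rw [adjIdeal, adjIdeal, Matrix.adjugate_submatrix_equiv_self]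
  congr 1
  exact (Equiv.prodCongr e e).surjective.range_comp (fun p : V × V => M.adjugate p.1 p.2)

lemma adj_blockDiag {A : Matrix V V R} {B : Matrix V' V' R} (hA : A.det ≠ 0) (hB : B.det ≠ 0) :
    (Matrix.fromBlocks A 0 0 B).adjugate =
      Matrix.fromBlocks (B.det • A.adjugate) 0 0 (A.det • B.adjugate) := by
  have hd : (Matrix.fromBlocks A 0 0 B).det = A.det * B.det := Matrix.det_fromBlocks_zero₁₂ _ _ _
  have h1 : Matrix.fromBlocks A 0 0 B *
      Matrix.fromBlocks (B.det • A.adjugate) 0 0 (A.det • B.adjugate) =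
      (A.det * B.det) • (1 : Matrix (V ⊕ V') (V ⊕ V') R) := by
    rw [Matrix.fromBlocks_multiply, ← Matrix.fromBlocks_one, Matrix.fromBlocks_smul]
    simp only [Matrix.zero_mul, Matrix.mul_zero, add_zero, zero_add, Matrix.mul_smul,
      Matrix.mul_adjugate, smul_smul, smul_zero]
    rw [mul_comm B.det]
  have h2 := congrArg (fun N => (Matrix.fromBlocks A 0 0 B).adjugate * N) h1
  simp only [← Matrix.mul_assoc, Matrix.adjugate_mul, hd, Matrix.mul_smul, Matrix.mul_one,
    Matrix.smul_mul, Matrix.one_mul] at h2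
  ext i j
  have h3 := congrFun (congrFun h2 i) j
  simp only [Matrix.smul_apply, smul_eq_mul] at h3
  exact (mul_left_cancel₀ (mul_ne_zero hA hB) h3).symm

lemma PdLT.blockDiag [Nonempty V] [Nonempty V'] {A : Matrix V V R} {B : Matrix V' V' R}
    (hA : A.det ≠ 0) (hB : B.det ≠ 0)
    (hrel : ∀ p, A.det ∣ B.det * p → A.det ∣ p) {n : ℕ}
    (h1 : PdLT R (adjIdeal A) (n + 2)) (h2 : PdLT R (adjIdeal B) (n + 2)) :
    PdLT R (adjIdeal (Matrix.fromBlocks A 0 0 B)) (n + 2) := by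
  have hgenA : ∀ i j, B.det * A.adjugate i j ∈ adjIdeal (Matrix.fromBlocks A 0 0 B) := by
    intro i j
    refine Ideal.subset_span ⟨(Sum.inl i, Sum.inl j), ?_⟩
    simp only [adj_blockDiag hA hB]; rfl
  have hgenB : ∀ i j, A.det * B.adjugate i j ∈ adjIdeal (Matrix.fromBlocks A 0 0 B) := by
    intro i j
    refine Ideal.subset_span ⟨(Sum.inr i, Sum.inr j), ?_⟩
    simp only [adj_blockDiag hA hB]; rfl
  refine PdLT.ideal_sum (det_mem_adjIdeal A) (det_mem_adjIdeal B) hA hrel ?_ ?_ ?_ h1 h2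
  · intro p hp
    induction hp using Submodule.span_induction with
    | mem x hx => obtain ⟨q, rfl⟩ := hx; exact hgenA _ _
    | zero => simp
    | add x y _ _ hx hy => rw [mul_add]; exact add_mem hx hy
    | smul c x _ hx => rw [smul_eq_mul, mul_left_comm]; exact Ideal.mul_mem_left _ _ hx
  · intro p hp
    induction hp using Submodule.span_induction with
    | mem x hx => obtain ⟨q, rfl⟩ := hx; exact hgenB _ _
    | zero => simp
    | add x y _ _ hx hy => rw [mul_add]; exact add_mem hx hy
    | smul c x _ hx => rw [smul_eq_mul, mul_left_comm]; exact Ideal.mul_mem_left _ _ hx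
  · intro y hy
    induction hy using Submodule.span_induction with
    | mem x hx =>
      obtain ⟨⟨i, j⟩, rfl⟩ := hx
      simp only [adj_blockDiag hA hB]
      rcases i with i | i <;> rcases j with j | j
      · exact ⟨A.adjugate i j, Ideal.subset_span ⟨(i, j), rfl⟩, 0, zero_mem _, by simp⟩
      · exact ⟨0, zero_mem _, 0, zero_mem _, by simp⟩
      · exact ⟨0, zero_mem _, 0, zero_mem _, by simp⟩
      · exact ⟨0, zero_mem _, B.adjugate i j, Ideal.subset_span ⟨(i, j), rfl⟩, by simp⟩
    | zero => exact ⟨0, zero_mem _, 0, zero_mem _, by simp⟩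
    | add x y _ _ hx hy =>
      obtain ⟨p, hp, q, hq, rfl⟩ := hx
      obtain ⟨p', hp', q', hq', rfl⟩ := hy
      exact ⟨p + p', add_mem hp hp', q + q', add_mem hq hq', by ring⟩
    | smul c x _ hx =>
      obtain ⟨p, hp, q, hq, rfl⟩ := hx
      exact ⟨c * p, Ideal.mul_mem_left _ _ hp, c * q, Ideal.mul_mem_left _ _ hq, by
        rw [smul_eq_mul]; ring⟩

end Disc

section Main
set_option linter.unusedSectionVars false
universe u
variable {K : Type u} [Field K] {σ : Type}

lemma pd_subsingleton {V : Type} [Fintype V] [DecidableEq V] [Nonempty V] [Subsingleton V]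
    (M : Matrix V V (MvPolynomial σ K)) :
    PdLT (MvPolynomial σ K) (adjIdeal M) 1 := by
  have : adjIdeal M = ⊤ := by
    obtain ⟨v⟩ := ‹Nonempty V›
    rw [Ideal.eq_top_iff_one]
    refine Ideal.subset_span ⟨(v, v), ?_⟩
    simp [Matrix.adjugate_subsingleton]
  rw [this]
  exact PdLT.of_equiv Submodule.topEquiv.symm PdLT.of_projective

lemma pd_adjIdeal : ∀ n, ∀ (V : Type) [Fintype V] [DecidableEq V] [Nonempty V] (ι : Sym2 V → σ)
    (_ : Function.Injective ι) (G : SimpleGraph V), Fintype.card V = n →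
    (symMat K ι G).det ≠ 0 ∧ PdLT (MvPolynomial σ K) (adjIdeal (symMat K ι G)) 3 ∧
      (G = ⊥ → PdLT (MvPolynomial σ K) (adjIdeal (symMat K ι G)) 2) := by
  intro n
  induction n using Nat.strong_induction_on with
  | _ n ih =>
  intro V _ _ _ ι hι G hn
  by_cases hG : G.Connected
  · have hgood := good_of_connected (K := K) n V ι hι G hG hn
    refine ⟨hgood.det_ne, hgood.pdLT, ?_⟩
    rintro rfl
    have : Subsingleton V := by
      rw [← not_nontrivial_iff_subsingleton]
      intro _
      obtain ⟨v⟩ := ‹Nonempty V›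
      obtain ⟨u, hu⟩ := hG.preconnected.exists_adj_of_nontrivial v
      exact hu
    exact (pd_subsingleton _).mono (by norm_num)
  · have : ∃ S : Set V, S.Nonempty ∧ Sᶜ.Nonempty ∧ ∀ i ∈ S, ∀ j ∈ Sᶜ, ¬ G.Adj i j := by
      have hpre : ¬ G.Preconnected := fun h => hG ⟨h⟩
      simp only [SimpleGraph.Preconnected, not_forall] at hpre
      obtain ⟨a, b, hab⟩ := hpre
      refine ⟨{w | G.Reachable a w}, ⟨a, SimpleGraph.Reachable.refl a⟩, ⟨b, hab⟩, ?_⟩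
      intro i hi j hj hij
      exact hj (SimpleGraph.Reachable.trans hi hij.reachable)
    obtain ⟨S, hS, hSc, hadj⟩ := this
    have hcard : Fintype.card S + Fintype.card (Sᶜ : Set V) = n := by
      rw [← hn, ← Fintype.card_sum]
      exact Fintype.card_congr (Equiv.Set.sumCompl S)
    have hne1 : Nonempty S := hS.to_subtype
    have hne2 : Nonempty (Sᶜ : Set V) := hSc.to_subtype
    have hp1 : 0 < Fintype.card S := Fintype.card_pos
    have hp2 : 0 < Fintype.card (Sᶜ : Set V) := Fintype.card_pos
    let ι₁ : Sym2 S → σ := ι ∘ Sym2.map Subtype.val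
    let ι₂ : Sym2 (Sᶜ : Set V) → σ := ι ∘ Sym2.map Subtype.val
    obtain ⟨d1, p1, q1⟩ := ih (Fintype.card S) (by omega) S ι₁
      (hι.comp (Sym2.map.injective Subtype.val_injective)) (G.induce S) rfl
    obtain ⟨d2, p2, q2⟩ := ih (Fintype.card (Sᶜ : Set V)) (by omega) (Sᶜ : Set V) ι₂
      (hι.comp (Sym2.map.injective Subtype.val_injective)) (G.induce Sᶜ) rfl
    have hblock : (symMat K ι G).submatrix (Equiv.Set.sumCompl S) (Equiv.Set.sumCompl S) =
        Matrix.fromBlocks (symMat K ι₁ (G.induce S)) 0 0 (symMat K ι₂ (G.induce Sᶜ)) := by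
      ext1 i j
      rw [Matrix.submatrix_apply]
      rcases i with i | i <;> rcases j with j | j
      · have h4 : (i : V) = j ↔ i = j := Subtype.ext_iff.symm
        simp [symMat_apply, ι₁, h4]
      · have h4 : (i : V) ≠ j := fun h => j.2 (h ▸ i.2)
        simp [symMat_apply, h4, hadj i i.2 j j.2]
      · have h4 : (i : V) ≠ j := fun h => i.2 (h ▸ j.2)
        have h5 : ¬ G.Adj i j := fun h => hadj j j.2 i i.2 h.symm
        simp [symMat_apply, h4, h5]
      · have h4 : (i : V) = j ↔ i = j := Subtype.ext_iff.symm
        simp [symMat_apply, ι₂, h4]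
    have hrel : ∀ p, (symMat K ι₁ (G.induce S)).det ∣ (symMat K ι₂ (G.induce Sᶜ)).det * p →
        (symMat K ι₁ (G.induce S)).det ∣ p := by
      apply H_of_irred d1
      intro p hp h1 h2
      apply hp.not_isUnit
      apply isUnit_of_kill hp.ne_zero
      intro s
      by_cases hs : ∃ i j : S, ι s((i : V), (j : V)) = s
      · obtain ⟨i, j, rfl⟩ := hs
        refine kill_of_dvd h2 d2 (kill_det_self (kill_symMat _ _ _ ?_))
        intro i' j' _ h
        have h3 : s((i' : V), (j' : V)) = s((i : V), (j : V)) := hι h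
        have h4 : (i : V) ∈ s((i' : V), (j' : V)) := by rw [h3]; simp
        rcases Sym2.mem_iff.1 h4 with h5 | h5
        · exact i'.2 (h5 ▸ i.2)
        · exact j'.2 (h5 ▸ i.2)
      · refine kill_of_dvd h1 d1 (kill_det_self (kill_symMat _ _ _ ?_))
        intro i j _ h
        exact hs ⟨i, j, h⟩
    refine ⟨?_, ?_, ?_⟩
    · rw [← Matrix.det_submatrix_equiv_self (Equiv.Set.sumCompl S), hblock,
        Matrix.det_fromBlocks_zero₁₂]
      exact mul_ne_zero d1 d2
    · rw [← adjIdeal_reindex (Equiv.Set.sumCompl S), hblock]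
      exact PdLT.blockDiag (n := 1) d1 d2 hrel p1 p2
    · rintro rfl
      rw [← adjIdeal_reindex (Equiv.Set.sumCompl S), hblock]
      refine PdLT.blockDiag (n := 0) d1 d2 hrel (q1 ?_) (q2 ?_)
      · ext i j; simp
      · ext i j; simp

end Main

section Part11
lemma exists_succAbove_perm {m : ℕ} (f : Fin m → Fin (m + 1)) (hf : Function.Injective f) :
    ∃ (i : Fin (m + 1)) (e : Equiv.Perm (Fin m)), f = i.succAbove ∘ e := by
  have h1 : ∃ i, i ∉ Set.range f := by
    by_contra h
    push Not at h
    have : Function.Surjective f := h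
    have := Fintype.card_le_of_surjective f this
    simp at this
  obtain ⟨i, hi⟩ := h1
  have h2 : ∀ x, ∃ y, i.succAbove y = f x := fun x =>
    Fin.exists_succAbove_eq (fun h => hi ⟨x, h⟩)
  choose g hg using h2
  have hgi : Function.Injective g := fun a b h => hf (by rw [← hg a, ← hg b, h])
  exact ⟨i, Equiv.ofBijective g (Finite.injective_iff_bijective.1 hgi),
    funext fun x => (hg x).symm⟩

lemma det_submatrix_perm_mem {R : Type*} [CommRing R] {m : ℕ} {I : Ideal R}
    (A : Matrix (Fin m) (Fin m) R) (e e' : Equiv.Perm (Fin m)) (h : A.det ∈ I) :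
    (A.submatrix e e').det ∈ I := by
  have : A.submatrix e e' = (A.submatrix id e').submatrix e id := rfl
  rw [this, Matrix.det_permute, Matrix.det_permute']
  exact I.mul_mem_left _ (I.mul_mem_left _ h)

lemma minorsIdeal_eq {R : Type*} [CommRing R] {n : ℕ} (hn : 2 ≤ n)
    (M : Matrix (Fin n) (Fin n) R) : minorsIdeal (n - 1) M = adjIdeal M := by
  obtain ⟨m, rfl⟩ : ∃ m, n = m + 1 := ⟨n - 1, by omega⟩
  have key : ∀ i j : Fin (m + 1), M.adjugate i j =
      (-1) ^ (j + i : ℕ) * (M.submatrix j.succAbove i.succAbove).det := fun i j =>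
    Matrix.adjugate_fin_succ_eq_det_submatrix M i j
  apply le_antisymm
  · rw [minorsIdeal, Ideal.span_le]
    rintro d ⟨f, g, hf, hg, rfl⟩
    obtain ⟨j, e, rfl⟩ := exists_succAbove_perm f hf
    obtain ⟨i, e', rfl⟩ := exists_succAbove_perm g hg
    refine det_submatrix_perm_mem (M.submatrix j.succAbove i.succAbove) e e' ?_
    have h1 : M.adjugate i j ∈ adjIdeal M := Ideal.subset_span ⟨(i, j), rfl⟩
    have h2 := (adjIdeal M).mul_mem_left ((-1) ^ (j + i : ℕ)) h1
    rw [key, ← mul_assoc, ← pow_add, ← two_mul, pow_mul] at h2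
    simpa using h2
  · rw [adjIdeal, Ideal.span_le]
    rintro _ ⟨⟨i, j⟩, rfl⟩
    dsimp only
    rw [key]
    refine Ideal.mul_mem_left _ _ (Ideal.subset_span ⟨j.succAbove, i.succAbove,
      Fin.succAbove_right_injective, Fin.succAbove_right_injective, rfl⟩)

universe u
lemma PdLT.quot {R : Type u} [CommRing R] {I : Ideal R} {n : ℕ} (h : PdLT R I n) :
    PdLT R (R ⧸ I) (n + 1) :=
  PdLT.of_exact I.subtype I.mkQ I.injective_subtype I.mkQ_surjective
    (LinearMap.exact_subtype_mkQ I) h (PdLT.of_projective.mono (by omega))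

lemma adjIdeal_mul_le_right {R : Type*} [CommRing R] {V : Type} [Fintype V] [DecidableEq V]
    (A B : Matrix V V R) : adjIdeal (A * B) ≤ adjIdeal B := by
  rw [adjIdeal, Ideal.span_le]
  rintro _ ⟨p, rfl⟩
  simp only [Matrix.adjugate_mul_distrib, Matrix.mul_apply]
  exact sum_mem fun k _ => Ideal.mul_mem_right _ _ (Ideal.subset_span ⟨(p.1, k), rfl⟩)

lemma adjIdeal_mul_le_left {R : Type*} [CommRing R] {V : Type} [Fintype V] [DecidableEq V]
    (A B : Matrix V V R) : adjIdeal (A * B) ≤ adjIdeal A := by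
  rw [adjIdeal, Ideal.span_le]
  rintro _ ⟨p, rfl⟩
  simp only [Matrix.adjugate_mul_distrib, Matrix.mul_apply]
  exact sum_mem fun k _ => Ideal.mul_mem_left _ _ (Ideal.subset_span ⟨(k, p.2), rfl⟩)

lemma adjIdeal_mul_unit {R : Type*} [CommRing R] {V : Type} [Fintype V] [DecidableEq V]
    (A B C : Matrix V V R) (hA : A.det = 1) (hC : C.det = 1) :
    adjIdeal (A * B * C) = adjIdeal B := by
  apply le_antisymm
  · exact (adjIdeal_mul_le_left _ _).trans (adjIdeal_mul_le_right _ _)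
  · have : B = A.adjugate * (A * B * C) * C.adjugate := by
      rw [Matrix.mul_assoc, Matrix.mul_assoc (A * B), Matrix.mul_adjugate, ← Matrix.mul_assoc,
        ← Matrix.mul_assoc, Matrix.adjugate_mul, hA, hC]
      simp
    conv_lhs => rw [this]
    exact (adjIdeal_mul_le_left _ _).trans (adjIdeal_mul_le_right _ _)

/-- Schur complement reduction of the ideal of submaximal minors. -/
lemma adjIdeal_schur {R : Type*} [CommRing R] [IsDomain R] {W : Type} [Fintype W] [DecidableEq W]
    (A : Matrix (Fin 2) (Fin 2) R) (B : Matrix (Fin 2) W R) (C : Matrix W (Fin 2) R)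
    (D D' : Matrix W W R) (hD : D * D' = 1) (hdet : (Matrix.fromBlocks A B C D).det ≠ 0) :
    adjIdeal (Matrix.fromBlocks A B C D) =
      Ideal.span (Set.range fun p : Fin 2 × Fin 2 => (A - B * D' * C) p.1 p.2) := by
  let _ : Invertible D := ⟨D', mul_eq_one_comm.1 hD, hD⟩
  have hinv : ⅟D = D' := rfl
  have h1 := Matrix.fromBlocks_eq_of_invertible₂₂ A B C D
  rw [hinv] at h1
  set S := A - B * D' * C with hS
  have hu : (Matrix.fromBlocks 1 (B * D') 0 1 : Matrix (Fin 2 ⊕ W) (Fin 2 ⊕ W) R).det = 1 := by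
    rw [Matrix.det_fromBlocks_zero₂₁]; simp
  have hv : (Matrix.fromBlocks 1 0 (D' * C) 1 : Matrix (Fin 2 ⊕ W) (Fin 2 ⊕ W) R).det = 1 := by
    rw [Matrix.det_fromBlocks_zero₁₂]; simp
  have hDu : D.det * D'.det = 1 := by rw [← Matrix.det_mul, hD, Matrix.det_one]
  have hD0 : D.det ≠ 0 := left_ne_zero_of_mul_eq_one hDu
  have hS0 : S.det ≠ 0 := by
    intro h
    apply hdet
    rw [h1, Matrix.det_mul, Matrix.det_mul, Matrix.det_fromBlocks_zero₁₂ S, h]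
    simp
  rw [h1, adjIdeal_mul_unit _ _ _ hu hv, adjIdeal, adj_blockDiag hS0 hD0]
  have hmem : ∀ i j, S i j ∈ Ideal.span (Set.range fun p : Fin 2 × Fin 2 => S p.1 p.2) :=
    fun i j => Ideal.subset_span ⟨(i, j), rfl⟩
  apply le_antisymm
  · rw [Ideal.span_le]
    rintro _ ⟨⟨i | i, j | j⟩, rfl⟩
    · dsimp only
      rw [Matrix.fromBlocks_apply₁₁, Matrix.smul_apply, smul_eq_mul]
      apply Ideal.mul_mem_left
      rw [Matrix.adjugate_fin_two]
      fin_cases i <;> fin_cases j <;> simp [hmem]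
    · simp
    · simp
    · dsimp only
      rw [Matrix.fromBlocks_apply₂₂, Matrix.smul_apply, smul_eq_mul]
      apply Ideal.mul_mem_right
      rw [Matrix.det_fin_two]
      exact sub_mem (Ideal.mul_mem_left _ _ (hmem _ _)) (Ideal.mul_mem_left _ _ (hmem _ _))
  · rw [Ideal.span_le]
    set J := Ideal.span (Set.range fun p : (Fin 2 ⊕ W) × (Fin 2 ⊕ W) =>
      (Matrix.fromBlocks (D.det • S.adjugate) 0 0 (S.det • D.adjugate)) p.1 p.2) with hJ
    have h3 : ∀ i j, S.adjugate i j ∈ J := by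
      intro i j
      have h4 : D.det * S.adjugate i j ∈ J := Ideal.subset_span ⟨(Sum.inl i, Sum.inl j), rfl⟩
      have h5 := J.mul_mem_left D'.det h4
      rwa [← mul_assoc, mul_comm D'.det, hDu, one_mul] at h5
    have h6 : ∀ i j, S i j ∈ J := by
      rw [Matrix.adjugate_fin_two] at h3
      intro i j
      have a := h3 0 0
      have b := h3 0 1
      have c := h3 1 0
      have d := h3 1 1
      simp at a b c d
      fin_cases i <;> fin_cases j <;> assumption
    rintro _ ⟨⟨i, j⟩, rfl⟩
    exact h6 i j

end Part11


section Lower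
set_option linter.unusedSectionVars false
open CategoryTheory
universe u

lemma PdLT.localize_aux {R : Type u} [CommRing R] (S : Submonoid R) (M : ModuleCat.{u} R) (n : ℕ)
    (h : HasProjectiveDimensionLE M n) {N : Type u} [AddCommGroup N] [Module R N]
    [Module (Localization S) N] [IsScalarTower R (Localization S) N] (f : M →ₗ[R] N)
    [IsLocalizedModule S f] : PdLT (Localization S) N (n + 1) := by
  have h1 := ModuleCat.localizedModule_hasProjectiveDimensionLE n S M
  have h2 : PdLT (Localization S) (M.localizedModule S) (n + 1) := h1
  exact PdLT.of_equiv (LinearEquiv.extendScalarsOfIsLocalization S (Localization S)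
    (IsLocalizedModule.linearEquiv S (M.localizedModuleMkLinearMap S) f)) h2

lemma PdLT.localize {R : Type u} [CommRing R] (S : Submonoid R) (I : Ideal R) (n : ℕ)
    (h : PdLT R (R ⧸ I) (n + 1)) :
    PdLT (Localization S) (Localization S ⧸ I.map (algebraMap R (Localization S))) (n + 1) := by
  rw [← Ideal.localized'_eq_map (Localization S) S I]
  exact PdLT.localize_aux S (ModuleCat.of R (R ⧸ I)) n h
    (Submodule.toLocalizedQuotient' (Localization S) S (Algebra.linearMap R (Localization S)) I)

lemma not_pdLT_of_regular {L : Type u} [CommRing L] [IsLocalRing L] [IsNoetherianRing L]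
    (rs : List L) (h : RingTheory.Sequence.IsRegular L rs) :
    ¬ PdLT L (L ⧸ Ideal.ofList rs) rs.length := by
  intro h'
  have h1 := ModuleCat.projectiveDimension_quotient_eq_length.{u} rs h
  have h2 : PdLT L (Shrink.{u} (L ⧸ Ideal.ofList rs)) rs.length :=
    PdLT.of_equiv (Shrink.linearEquiv L _).symm h'
  have h3 := (projectiveDimension_lt_iff (n := rs.length)).2 h2
  exact absurd h1 h3.ne

/-- If `J = ker ψ` with `ψ` an endomorphism of a domain and `ψ x ≠ 0`, then `x` is regular on
the quotient by `J`. -/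
lemma isSMulRegular_of_ker {L : Type u} [CommRing L] [IsDomain L] (J : Ideal L) (ψ : L →+* L)
    (hJ : RingHom.ker ψ = J) (x : L) (hx : ψ x ≠ 0) :
    IsSMulRegular (L ⧸ (J • ⊤ : Submodule L L)) x := by
  have hJ' : (J • ⊤ : Submodule L L) = J := by simp
  rw [hJ', isSMulRegular_iff_right_eq_zero_of_smul]
  intro y
  obtain ⟨y, rfl⟩ := Submodule.Quotient.mk_surjective _ y
  rw [← Submodule.Quotient.mk_smul, Submodule.Quotient.mk_eq_zero, Submodule.Quotient.mk_eq_zero,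
    ← hJ, smul_eq_mul, RingHom.mem_ker, RingHom.mem_ker, map_mul]
  intro h
  exact (mul_eq_zero.1 h).resolve_left hx

variable {K : Type u} [Field K] {σ : Type} [Finite σ] (m : Ideal (MvPolynomial σ K)) [m.IsPrime]

local notation "LL" => Localization.AtPrime m
local notation "xx" => fun v => algebraMap (MvPolynomial σ K) (Localization.AtPrime m) (X v)

lemma exists_subst (d : σ → LL) (hd : ∀ v, d v ∈ IsLocalRing.maximalIdeal LL) :
    ∃ ψ : LL →+* LL, (∀ v, ψ (xx v) = xx v - d v) ∧
      ∀ (J : Ideal LL), (∀ v, d v ∈ J) → ∀ z, ψ z - z ∈ J := by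
  let φ : MvPolynomial σ K →+* LL :=
    eval₂Hom ((algebraMap (MvPolynomial σ K) LL).comp C) (fun v => xx v - d v)
  have hφ : ∀ (J : Ideal LL), (∀ v, d v ∈ J) → ∀ z, φ z - algebraMap _ LL z ∈ J := by
    intro J hJ z
    rw [← Ideal.Quotient.eq]
    have : (Ideal.Quotient.mk J).comp φ =
        (Ideal.Quotient.mk J).comp (algebraMap (MvPolynomial σ K) LL) := by
      apply MvPolynomial.ringHom_ext
      · intro r; simp [φ]
      · intro v
        simp only [φ, RingHom.comp_apply, coe_eval₂Hom, eval₂_X]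
        rw [Ideal.Quotient.eq]
        simpa using hJ v
    exact RingHom.congr_fun this z
  have hu : ∀ y : m.primeCompl, IsUnit (φ y) := by
    intro y
    have h1 := hφ _ hd y
    have h2 : IsUnit (algebraMap (MvPolynomial σ K) LL y) := IsLocalization.map_units _ y
    by_contra h3
    have h4 : φ y ∈ IsLocalRing.maximalIdeal LL := h3
    have h5 := sub_mem h4 h1
    rw [sub_sub_cancel] at h5
    exact h5 h2
  have hl : ∀ z, IsLocalization.lift (M := m.primeCompl) hu (algebraMap _ LL z) = φ z :=
    fun z => IsLocalization.lift_eq hu z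
  refine ⟨IsLocalization.lift (M := m.primeCompl) hu, fun v => ?_, fun J hJ z => ?_⟩
  · rw [hl]; simp [φ]
  · rw [← Ideal.Quotient.eq]
    have : (Ideal.Quotient.mk J).comp (IsLocalization.lift (M := m.primeCompl) hu) =
        (Ideal.Quotient.mk J) := by
      apply IsLocalization.ringHom_ext m.primeCompl
      refine RingHom.ext fun z => ?_
      simp only [RingHom.comp_apply, hl]
      rw [Ideal.Quotient.eq]
      exact hφ J hJ _
    exact RingHom.congr_fun this z

/-- `x_v - p_v` for `v` in a duplicate free list, `p_v` not involving the variables of the list. -/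
lemma regular_seq (l : List σ) (hl : l.Nodup) (p : σ → LL)
    (hx : ∀ v ∈ l, X v ∈ m)
    (hp : ∀ v ∈ l, p v ∈ IsLocalRing.maximalIdeal LL)
    (hfix : ∀ ψ : LL →+* LL, (∀ v, v ∉ l → ψ (xx v) = xx v) → ∀ v ∈ l, ψ (p v) = p v) :
    RingTheory.Sequence.IsRegular LL (l.map fun v => xx v - p v) := by
  have hxm : ∀ v ∈ l, xx v ∈ IsLocalRing.maximalIdeal LL := fun v hv =>
    (IsLocalization.AtPrime.to_map_mem_maximal_iff LL m _).2 (hx v hv)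
  have hinj : Function.Injective (algebraMap (MvPolynomial σ K) LL) :=
    IsLocalization.injective _ m.primeCompl_le_nonZeroDivisors
  have hne : ∀ v ∈ l, xx v - p v ≠ 0 := by
    intro v hv h0
    obtain ⟨ψ, h1, -⟩ := exists_subst m (fun w => if w = v then xx v else 0) (by
      intro w; split_ifs
      · exact hxm v hv
      · exact zero_mem _)
    have h2 := hfix ψ (fun w hw => by
      rw [h1, if_neg (by rintro rfl; exact hw hv), sub_zero]) v hv
    rw [← sub_eq_zero.1 h0, h1] at h2
    simp only [if_true, sub_self] at h2
    have := hinj (h2.symm.trans (map_zero _).symm)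
    exact X_ne_zero v this
  refine ⟨⟨fun i hi => ?_⟩, ?_⟩
  · rw [List.length_map] at hi
    obtain ⟨ψ, h1, h2⟩ := exists_subst m (fun w => if w ∈ l.take i then xx w - p w else 0) (by
      intro w; split_ifs with h
      · exact sub_mem (hxm w (List.mem_of_mem_take h)) (hp w (List.mem_of_mem_take h))
      · exact zero_mem _)
    have h3 := hfix ψ (fun w hw => by
      rw [h1, if_neg (fun h => hw (List.mem_of_mem_take h)), sub_zero])
    have hgen : ∀ w ∈ l.take i, xx w - p w ∈ Ideal.ofList ((l.map fun v => xx v - p v).take i) := by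
      intro w hw
      apply Ideal.subset_span
      rw [← List.map_take]
      exact List.mem_map.2 ⟨w, hw, rfl⟩
    refine isSMulRegular_of_ker _ ψ (le_antisymm ?_ ?_) _ ?_
    · intro z hz
      have := h2 (Ideal.ofList ((l.map fun v => xx v - p v).take i)) (by
        intro w; split_ifs with h
        · exact hgen w h
        · exact zero_mem _) z
      rw [RingHom.mem_ker.1 hz, zero_sub] at this
      exact neg_mem_iff.1 this
    · rw [Ideal.ofList, Ideal.span_le, ← List.map_take]
      intro z hz
      obtain ⟨w, hw, rfl⟩ := List.mem_map.1 hz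
      rw [SetLike.mem_coe, RingHom.mem_ker, map_sub, h1, if_pos hw,
        h3 w (List.mem_of_mem_take hw)]
      ring
    · have hnot : l[i] ∉ l.take i := by
        intro h
        obtain ⟨j, hj, hij⟩ := List.mem_take_iff_getElem.1 h
        have := (List.Nodup.getElem_inj_iff hl).1 hij
        omega
      rw [List.getElem_map, map_sub, h1, if_neg hnot, sub_zero, h3 _ (List.getElem_mem _)]
      exact hne _ (List.getElem_mem _)
  · intro h
    have h1 : Ideal.ofList (l.map fun v => xx v - p v) ≤ IsLocalRing.maximalIdeal LL := by
      rw [Ideal.ofList, Ideal.span_le]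
      intro z hz
      obtain ⟨w, hw, rfl⟩ := List.mem_map.1 hz
      exact sub_mem (hxm w hw) (hp w hw)
    have h2 : (Ideal.ofList (l.map fun v => xx v - p v)) • (⊤ : Submodule LL LL) =
      Ideal.ofList (l.map fun v => xx v - p v) := by simp
    rw [h2] at h
    rw [← h] at h1
    exact (IsLocalRing.maximalIdeal.isMaximal LL).ne_top (top_le_iff.1 h1)

end Lower

section Part13

section Lower2
set_option linter.unusedSectionVars false
universe u

lemma adjIdeal_map {R S : Type*} [CommRing R] [CommRing S] {V : Type} [Fintype V] [DecidableEq V]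
    (f : R →+* S) (M : Matrix V V R) : (adjIdeal M).map f = adjIdeal (M.map f) := by
  rw [adjIdeal, adjIdeal, Ideal.map_span, ← Set.range_comp]
  congr 2
  funext p
  have := RingHom.map_adjugate f M
  rw [RingHom.mapMatrix_apply, RingHom.mapMatrix_apply] at this
  rw [← this]
  rfl

variable {K : Type u} [Field K] {σ : Type} [Finite σ] {W : Type} [Fintype W] [DecidableEq W]
  (ι : Sym2 (Fin 2 ⊕ W) → σ) (hι : Function.Injective ι) (G : SimpleGraph (Fin 2 ⊕ W))

/-- Evaluation at the point where the `W`-diagonal is `1` and everything else is `0`. -/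
noncomputable def evPt (K : Type u) [Field K] (ι : Sym2 (Fin 2 ⊕ W) → σ) : MvPolynomial σ K →ₐ[K] K :=
  aeval (fun v => if ∃ w : W, v = ι s(Sum.inr w, Sum.inr w) then (1 : K) else 0)

lemma evPt_inr (w : W) : evPt K ι (X (ι s(Sum.inr w, Sum.inr w))) = 1 := by
  rw [evPt, aeval_X, if_pos ⟨w, rfl⟩]

lemma evPt_other (hι : Function.Injective ι) (a b : Fin 2 ⊕ W)
    (h : ∀ w, ¬ (a = Sum.inr w ∧ b = Sum.inr w)) :
    evPt K ι (X (ι s(a, b))) = 0 := by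
  rw [evPt, aeval_X, if_neg]
  rintro ⟨w, hw⟩
  have := hι hw
  rw [Sym2.eq_iff] at this
  exact h w (by tauto)

instance evPt_prime : (RingHom.ker (evPt (σ := σ) K ι)).IsPrime := RingHom.ker_isPrime _

local notation "mm" => RingHom.ker (evPt (σ := σ) K ι)
local notation "LL" => Localization.AtPrime (RingHom.ker (evPt (σ := σ) K ι))

lemma lower_setup (hι : Function.Injective ι) : ∃ (A : Matrix (Fin 2) (Fin 2) LL)
    (P : Matrix (Fin 2) (Fin 2) LL),
    (∀ i j, A i j = algebraMap (MvPolynomial σ K) LL (symMat K ι G (Sum.inl i) (Sum.inl j))) ∧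
    (adjIdeal (symMat K ι G)).map (algebraMap (MvPolynomial σ K) LL) =
      Ideal.span (Set.range fun p : Fin 2 × Fin 2 => (A - P) p.1 p.2) ∧
    (∀ i j, P i j ∈ IsLocalRing.maximalIdeal LL) ∧
    (∀ ψ : LL →+* LL, (∀ a w, ψ (algebraMap (MvPolynomial σ K) LL (X (ι s(a, Sum.inr w)))) =
      algebraMap (MvPolynomial σ K) LL (X (ι s(a, Sum.inr w)))) → ∀ i j, ψ (P i j) = P i j) ∧
    P 1 0 = P 0 1 ∧ (G = ⊥ → P = 0) := by
  set N : Matrix (Fin 2 ⊕ W) (Fin 2 ⊕ W) LL := (symMat K ι G).map (algebraMap (MvPolynomial σ K) LL) with hN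
  have hNa : ∀ a b, N a b = algebraMap (MvPolynomial σ K) LL (symMat K ι G a b) := fun a b => rfl
  have hsymm : ∀ a b, N a b = N b a := by
    intro a b
    rw [hNa, hNa, symMat_apply, symMat_apply, Sym2.eq_swap, G.adj_comm, eq_comm (a := a)]
  set A := N.toBlocks₁₁ with hA
  set B := N.toBlocks₁₂ with hB
  set C := N.toBlocks₂₁ with hC
  set D := N.toBlocks₂₂ with hD
  have hblk : N = Matrix.fromBlocks A B C D := (Matrix.fromBlocks_toBlocks N).symm
  have hinj : Function.Injective (algebraMap (MvPolynomial σ K) LL) :=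
    IsLocalization.injective _ (mm).primeCompl_le_nonZeroDivisors
  have hdet : N.det ≠ 0 := by
    have h1 := (pd_adjIdeal (K := K) _ (Fin 2 ⊕ W) ι hι G rfl).1
    have h2 := RingHom.map_det (algebraMap (MvPolynomial σ K) LL) (symMat K ι G)
    rw [RingHom.mapMatrix_apply] at h2
    intro h0
    apply h1
    apply hinj
    rw [map_zero, h2, ← h0]
  have hDu : IsUnit D.det := by
    have h2 := RingHom.map_det (algebraMap (MvPolynomial σ K) LL) (symMat K ι G).toBlocks₂₂
    rw [RingHom.mapMatrix_apply] at h2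
    have h3 : D.det = algebraMap (MvPolynomial σ K) LL (symMat K ι G).toBlocks₂₂.det := h2.symm
    rw [h3]
    refine IsLocalization.map_units (M := (mm).primeCompl) LL
      ⟨(symMat K ι G).toBlocks₂₂.det, ?_⟩
    change ¬ (_ ∈ mm)
    rw [RingHom.mem_ker]
    have h4 := RingHom.map_det (evPt K ι).toRingHom (symMat K ι G).toBlocks₂₂
    have h5 : (evPt K ι).toRingHom.mapMatrix (symMat K ι G).toBlocks₂₂ = 1 := by
      ext w w'
      change evPt K ι (symMat K ι G (Sum.inr w) (Sum.inr w')) = _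
      rw [symMat_apply]
      by_cases hw : w = w'
      · subst hw
        rw [if_pos (Or.inl rfl), evPt_inr, Matrix.one_apply_eq]
      · rw [Matrix.one_apply_ne hw]
        split_ifs
        · apply evPt_other ι hι
          rintro w₁ ⟨h1, h2⟩
          exact hw (Sum.inr_injective (h1.trans h2.symm))
        · simp
    rw [h5, Matrix.det_one] at h4
    intro h6
    have h7 : (evPt K ι).toRingHom (symMat K ι G).toBlocks₂₂.det = 0 := h6
    rw [h7] at h4
    exact zero_ne_one h4
  have hDD : D * D⁻¹ = 1 := Matrix.mul_nonsing_inv _ hDu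
  have hCB : C = B.transpose := by
    ext w i
    exact hsymm _ _
  have hDT : D.transpose = D := by
    ext w w'
    exact hsymm _ _
  refine ⟨A, B * D⁻¹ * C, fun i j => rfl, ?_, ?_, ?_, ?_, ?_⟩
  · rw [adjIdeal_map, ← hN, hblk]
    exact adjIdeal_schur A B C D D⁻¹ hDD (hblk ▸ hdet)
  · intro i j
    rw [Matrix.mul_apply]
    refine sum_mem fun w _ => Ideal.mul_mem_left _ _ ?_
    change algebraMap (MvPolynomial σ K) LL (symMat K ι G (Sum.inr w) (Sum.inl j)) ∈ _
    rw [IsLocalization.AtPrime.to_map_mem_maximal_iff LL mm, RingHom.mem_ker, symMat_apply]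
    by_cases hc : (Sum.inr w : Fin 2 ⊕ W) = Sum.inl j ∨ G.Adj (Sum.inr w) (Sum.inl j)
    · rw [if_pos hc]
      exact evPt_other ι hι _ _ (by rintro w ⟨-, h⟩; cases h)
    · rw [if_neg hc, map_zero]
  · intro ψ hψ i j
    have hfix : ∀ a w, ψ (N a (Sum.inr w)) = N a (Sum.inr w) := by
      intro a w
      rw [hNa, symMat_apply]
      split_ifs
      · exact hψ a w
      · simp
    have hB' : B.map ψ = B := by ext i w; exact hfix _ _
    have hD' : D.map ψ = D := by ext i w; exact hfix _ _
    have hC' : C.map ψ = C := by rw [hCB, Matrix.transpose_map, hB']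
    have hDi : D⁻¹.map ψ = D⁻¹ := by
      have h1 : (D * D⁻¹).map ψ = 1 := by rw [hDD]; exact Matrix.map_one _ (map_zero ψ) (map_one ψ)
      rw [Matrix.map_mul, hD'] at h1
      exact (Matrix.inv_eq_right_inv h1).symm
    have : (B * D⁻¹ * C).map ψ = B * D⁻¹ * C := by
      rw [Matrix.map_mul, Matrix.map_mul, hB', hC', hDi]
    exact congrFun (congrFun this i) j
  · have : (B * D⁻¹ * C).transpose = B * D⁻¹ * C := by
      rw [Matrix.transpose_mul, Matrix.transpose_mul, Matrix.transpose_nonsing_inv, hDT, hCB,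
        Matrix.transpose_transpose, Matrix.mul_assoc]
    exact congrFun (congrFun this 0) 1
  · rintro rfl
    have : B = 0 := by
      ext i w
      change algebraMap (MvPolynomial σ K) LL (symMat K ι ⊥ (Sum.inl i) (Sum.inr w)) = 0
      rw [symMat_apply, if_neg (by simp), map_zero]
    rw [this, Matrix.zero_mul, Matrix.zero_mul]

lemma lower_edge (hι : Function.Injective ι) (hadj : G.Adj (Sum.inl 0) (Sum.inl 1)) :
    ¬ PdLT (MvPolynomial σ K) (MvPolynomial σ K ⧸ adjIdeal (symMat K ι G)) 3 := by
  intro h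
  have h1 := PdLT.localize (mm).primeCompl _ 2 h
  obtain ⟨A, P, hA, hI, hPm, hPf, hPs, -⟩ := lower_setup (K := K) ι G hι
  rw [hI] at h1
  have ne1 : ι s(Sum.inl 0, Sum.inl 0) ≠ ι s(Sum.inl 0, Sum.inl 1) := by
    intro h; simpa using hι h
  have ne2 : ι s(Sum.inl 0, Sum.inl 0) ≠ ι s(Sum.inl 1, Sum.inl 1) := by
    intro h; simpa using hι h
  have ne3 : ι s(Sum.inl 0, Sum.inl 1) ≠ ι s(Sum.inl 1, Sum.inl 1) := by
    intro h; simpa using hι h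
  set l : List σ := [ι s(Sum.inl 0, Sum.inl 0), ι s(Sum.inl 0, Sum.inl 1),
    ι s(Sum.inl 1, Sum.inl 1)] with hl
  set p : σ → LL := fun v => if v = ι s(Sum.inl 0, Sum.inl 0) then P 0 0 else
    if v = ι s(Sum.inl 0, Sum.inl 1) then P 0 1 else P 1 1 with hp
  have hreg := regular_seq mm l (by simp [hl, ne1, ne2, ne3]) p
    (by
      intro v hv
      have : ∀ i j : Fin 2, X (ι s(Sum.inl i, Sum.inl j)) ∈ mm := fun i j =>
        evPt_other ι hι _ _ (by rintro w ⟨h, -⟩; cases h)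
      simp only [hl, List.mem_cons, List.not_mem_nil, or_false] at hv
      rcases hv with rfl | rfl | rfl <;> exact this _ _)
    (by
      intro v _
      simp only [hp]
      split_ifs <;> exact hPm _ _)
    (by
      intro ψ hψ v _
      have h5 := hPf ψ (fun a w => hψ _ (by
        intro hv
        simp only [hl, List.mem_cons, List.not_mem_nil, or_false] at hv
        rcases hv with hv | hv | hv <;> simpa using hι hv))
      simp only [hp]
      split_ifs <;> exact h5 _ _)
  have h3 := not_pdLT_of_regular _ hreg
  apply h3
  have h4 : Ideal.ofList (l.map fun v => algebraMap (MvPolynomial σ K) LL (X v) - p v) =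
      Ideal.span (Set.range fun q : Fin 2 × Fin 2 => (A - P) q.1 q.2) := by
    have e00 : (A - P) 0 0 = algebraMap (MvPolynomial σ K) LL (X (ι s(Sum.inl 0, Sum.inl 0))) - P 0 0 := by
      rw [Matrix.sub_apply, hA, symMat_apply, if_pos (Or.inl rfl)]
    have e11 : (A - P) 1 1 = algebraMap (MvPolynomial σ K) LL (X (ι s(Sum.inl 1, Sum.inl 1))) - P 1 1 := by
      rw [Matrix.sub_apply, hA, symMat_apply, if_pos (Or.inl rfl)]
    have e01 : (A - P) 0 1 = algebraMap (MvPolynomial σ K) LL (X (ι s(Sum.inl 0, Sum.inl 1))) - P 0 1 := by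
      rw [Matrix.sub_apply, hA, symMat_apply, if_pos (Or.inr hadj)]
    have e10 : (A - P) 1 0 = algebraMap (MvPolynomial σ K) LL (X (ι s(Sum.inl 0, Sum.inl 1))) - P 0 1 := by
      rw [Matrix.sub_apply, hA, symMat_apply, if_pos (Or.inr hadj.symm), hPs, Sym2.eq_swap]
    rw [Ideal.ofList]
    congr 1
    ext z
    simp only [hl, hp, List.map_cons, List.map_nil, if_true, if_neg ne1.symm, if_neg ne2.symm,
      if_neg ne3.symm, List.mem_cons, List.not_mem_nil, or_false, Set.mem_range, Prod.exists,
      Fin.exists_fin_two, e00, e11, e01, e10, Set.mem_ofPred_eq]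
    tauto
  rw [h4]
  exact h1

lemma lower_bot (hι : Function.Injective ι) :
    ¬ PdLT (MvPolynomial σ K) (MvPolynomial σ K ⧸ adjIdeal (symMat K ι ⊥)) 2 := by
  intro h
  have h1 := PdLT.localize (mm).primeCompl _ 1 h
  obtain ⟨A, P, hA, hI, hPm, hPf, hPs, hP0⟩ := lower_setup (K := K) ι ⊥ hι
  rw [hI, hP0 rfl, sub_zero] at h1
  have ne2 : ι s(Sum.inl 0, Sum.inl 0) ≠ ι s(Sum.inl 1, Sum.inl 1) := by
    intro h; simpa using hι h
  set l : List σ := [ι s(Sum.inl 0, Sum.inl 0), ι s(Sum.inl 1, Sum.inl 1)] with hl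
  have hreg := regular_seq mm l (by simp [hl, ne2]) (fun _ => 0)
    (by
      intro v hv
      have : ∀ i j : Fin 2, X (ι s(Sum.inl i, Sum.inl j)) ∈ mm := fun i j =>
        evPt_other ι hι _ _ (by rintro w ⟨h, -⟩; cases h)
      simp only [hl, List.mem_cons, List.not_mem_nil, or_false] at hv
      rcases hv with rfl | rfl <;> exact this _ _)
    (fun _ _ => zero_mem _) (fun ψ _ v _ => map_zero ψ)
  have h3 := not_pdLT_of_regular _ hreg
  apply h3
  have h4 : Ideal.ofList (l.map fun v => algebraMap (MvPolynomial σ K) LL (X v) - 0) =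
      Ideal.span (Set.range fun q : Fin 2 × Fin 2 => A q.1 q.2) := by
    have e00 : A 0 0 = algebraMap (MvPolynomial σ K) LL (X (ι s(Sum.inl 0, Sum.inl 0))) := by
      rw [hA, symMat_apply, if_pos (Or.inl rfl)]
    have e11 : A 1 1 = algebraMap (MvPolynomial σ K) LL (X (ι s(Sum.inl 1, Sum.inl 1))) := by
      rw [hA, symMat_apply, if_pos (Or.inl rfl)]
    have e01 : A 0 1 = 0 := by
      rw [hA, symMat_apply, if_neg (by simp), map_zero]
    have e10 : A 1 0 = 0 := by
      rw [hA, symMat_apply, if_neg (by simp), map_zero]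
    simp only [sub_zero]
    apply le_antisymm
    · rw [Ideal.ofList, Ideal.span_le]
      intro z hz
      simp only [hl, List.map_cons, List.map_nil, List.mem_cons, List.not_mem_nil, or_false,
        Set.mem_ofPred_eq] at hz
      rcases hz with rfl | rfl
      · exact Ideal.subset_span ⟨(0, 0), e00⟩
      · exact Ideal.subset_span ⟨(1, 1), e11⟩
    · rw [Ideal.span_le]
      rintro _ ⟨⟨i, j⟩, rfl⟩
      have m0 : algebraMap (MvPolynomial σ K) LL (X (ι s(Sum.inl 0, Sum.inl 0))) ∈
          Ideal.ofList (l.map fun v => algebraMap (MvPolynomial σ K) LL (X v)) :=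
        Ideal.subset_span (List.mem_map.2 ⟨_, by simp [hl], rfl⟩)
      have m1 : algebraMap (MvPolynomial σ K) LL (X (ι s(Sum.inl 1, Sum.inl 1))) ∈
          Ideal.ofList (l.map fun v => algebraMap (MvPolynomial σ K) LL (X v)) :=
        Ideal.subset_span (List.mem_map.2 ⟨_, by simp [hl], rfl⟩)
      have h01 : A 0 1 ∈ Ideal.ofList (l.map fun v => algebraMap (MvPolynomial σ K) LL (X v)) := by
        rw [e01]; exact zero_mem _
      have h10 : A 1 0 ∈ Ideal.ofList (l.map fun v => algebraMap (MvPolynomial σ K) LL (X v)) := by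
        rw [e10]; exact zero_mem _
      have h00 := e00 ▸ m0
      have h11 := e11 ▸ m1
      fin_cases i <;> fin_cases j
      · exact h00
      · exact h01
      · exact h10
      · exact h11
  rw [h4]
  exact h1

end Lower2

/-- A decomposition of the vertex set with two prescribed vertices first. -/
lemma exists_split {n : ℕ} (i j : Fin n) (hij : i ≠ j) :
    ∃ (W : Type) (_ : Fintype W) (_ : DecidableEq W) (e : Fin 2 ⊕ W ≃ Fin n),
      e (Sum.inl 0) = i ∧ e (Sum.inl 1) = j := by
  let f : Fin 2 → Fin n := ![i, j]
  have hf : Function.Injective f := by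
    intro a b h
    fin_cases a <;> fin_cases b <;> simp_all [f]
  refine ⟨{x // ¬ x ∈ Set.range f}, inferInstance, inferInstance,
    (Equiv.sumCongr (Equiv.ofInjective f hf) (Equiv.refl _)).trans
      (Equiv.sumCompl (· ∈ Set.range f)), ?_, ?_⟩
  · simp [f]
  · simp [f]

universe u

lemma symMat_split {K : Type u} [Field K] {n : ℕ} (G : SimpleGraph (Fin n)) {W : Type} [Fintype W]
    [DecidableEq W] (e : Fin 2 ⊕ W ≃ Fin n) :
    adjIdeal (symMat K (fun s : Sym2 (Fin 2 ⊕ W) => s.map e) (G.comap e)) =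
      adjIdeal (symMat K (id : Sym2 (Fin n) → Sym2 (Fin n)) G) := by
  rw [← adjIdeal_reindex e (symMat K (id : Sym2 (Fin n) → Sym2 (Fin n)) G)]
  congr 1
  ext1 a b
  simp [symMat_apply]

theorem pd_main (K : Type u) [Field K] (n : ℕ) (hn : 2 ≤ n) (G : SimpleGraph (Fin n)) (k : ℕ) :
    PdLT (SymPolyRing K n) (SymPolyRing K n ⧸ minorsIdeal (n - 1) (sparseGenericSym K n G)) (k + 1)
      ↔ (if G.edgeSet.Nonempty then 3 else 2) ≤ k := by
  have e : minorsIdeal (n - 1) (sparseGenericSym K n G) =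
      adjIdeal (symMat K (id : Sym2 (Fin n) → Sym2 (Fin n)) G) := by
    have hM : sparseGenericSym K n G =
        symMat K (id : Sym2 (Fin n) → Sym2 (Fin n)) G := by
      ext1 i j
      simp only [sparseGenericSym, symMat_apply, id]
    rw [minorsIdeal_eq hn, hM]
  rw [e]
  have : Nonempty (Fin n) := ⟨⟨0, by omega⟩⟩
  obtain ⟨-, hup, hup'⟩ := pd_adjIdeal (K := K) n (Fin n)
    (id : Sym2 (Fin n) → Sym2 (Fin n)) Function.injective_id G (Fintype.card_fin n)
  have hinj : ∀ {W : Type} (e : Fin 2 ⊕ W ≃ Fin n),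
      Function.Injective (fun s : Sym2 (Fin 2 ⊕ W) => s.map e) := fun e =>
    Sym2.map.injective e.injective
  split_ifs with hG
  · refine ⟨fun h => ?_, fun h => (PdLT.quot hup).mono (by omega)⟩
    by_contra hk
    have h' := h.mono (show k + 1 ≤ 3 by omega)
    obtain ⟨s, hs⟩ := hG
    induction s using Sym2.ind with
    | _ i j =>
      have hij : G.Adj i j := hs
      obtain ⟨W, _, _, e, h0, h1⟩ := exists_split i j hij.ne
      refine lower_edge (K := K) (fun s : Sym2 (Fin 2 ⊕ W) => s.map e) (G.comap e) (hinj e) ?_ ?_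
      · rw [SimpleGraph.comap_adj, h0, h1]; exact hij
      · rw [symMat_split]; exact h'
  · have hbot : G = ⊥ := by
      rw [← SimpleGraph.edgeSet_eq_empty]
      exact Set.not_nonempty_iff_eq_empty.1 hG
    refine ⟨fun h => ?_, fun h => (PdLT.quot (hup' hbot)).mono (by omega)⟩
    by_contra hk
    have h' := h.mono (show k + 1 ≤ 2 by omega)
    obtain ⟨W, _, _, e, h0, h1⟩ := exists_split (⟨0, by omega⟩ : Fin n) ⟨1, by omega⟩ (by simp)
    have hb : G.comap e = ⊥ := by subst hbot; ext a b; simp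
    have := symMat_split (K := K) G e
    rw [hb] at this
    refine lower_bot (K := K) (fun s : Sym2 (Fin 2 ⊕ W) => s.map e) (hinj e) ?_
    rw [this]; exact h'

end Part13

/-- The projective dimension of the `R`-module `R/I_{n-1}(X_G)` — the least `k` such that
`R/I_{n-1}(X_G)` admits a projective resolution vanishing in homological degrees `> k` —
equals `3` if the graph `G` has at least one edge, and `2` if `G` has no edges at all. -/
theorem projDim_quotient_submaximalMinors_sparse_symmetric
    (K : Type*) [Field K] (n : ℕ) (hn : 2 ≤ n) (G : SimpleGraph (Fin n)) :
    IsLeast {k : ℕ | ∃ P : CategoryTheory.ProjectiveResolution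
        (ModuleCat.of (SymPolyRing K n)
          (SymPolyRing K n ⧸ minorsIdeal (n - 1) (sparseGenericSym K n G))),
        ∀ i, k < i → CategoryTheory.Limits.IsZero (P.complex.X i)}
      (if G.edgeSet.Nonempty then 3 else 2) := by
  have key : ∀ k, (∃ P : CategoryTheory.ProjectiveResolution
        (ModuleCat.of (SymPolyRing K n)
          (SymPolyRing K n ⧸ minorsIdeal (n - 1) (sparseGenericSym K n G))),
        ∀ i, k < i → CategoryTheory.Limits.IsZero (P.complex.X i)) ↔
      (if G.edgeSet.Nonempty then 3 else 2) ≤ k := fun k =>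
    (exists_resolution_iff _ k).trans (pd_main K n hn G k)
  exact ⟨(key _).2 le_rfl, fun k hk => (key k).1 hk⟩
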